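/- arXiv:math/0010291 — 2 statements merged into one kernel-verified Lean document; each statement's English description precedes it below -/
import Mathlib

section
/- Let F be the probability density on ℝ of φ_x under the measure μ_Λ(· | |φ_z| ≤ a, ∀z ∈ A), where μ_Λ is the gradient measure with even convex C² interaction V and symmetric kernel p, and A ⊆ Λ\{x}. Then F attains its maximum at 0; equivalently, F'(t) ≤ 0 for all t ≥ 0. -/
open MeasureTheory Real

/-- The gradient Hamiltonian `(1/2) ∑_{x,y} p(x-y) V(ψ_x - ψ_y)` in the volume `Λ`
(only pairs touching `Λ` contribute; outside `Λ` the field is frozen to `0`). -/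
noncomputable def hamiltonian {d : ℕ} (p : (Fin d → ℤ) → ℝ)
    (V : ℝ → ℝ) (Λ : Finset (Fin d → ℤ)) (ψ : (Fin d → ℤ) → ℝ) : ℝ :=
  (1 / 2) * ∑' q : (Fin d → ℤ) × (Fin d → ℤ),
    if q.1 ∈ Λ ∨ q.2 ∈ Λ then p (q.1 - q.2) * V (ψ q.1 - ψ q.2) else 0

/-- The configuration equal to `t` at `x`, to `ψ` on `Λ \ {x}`, and `0` outside `Λ`. -/
noncomputable def extendAt {d : ℕ} (Λ : Finset (Fin d → ℤ)) (x : Fin d → ℤ) (t : ℝ)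
    (ψ : {z // z ∈ Λ.erase x} → ℝ) : (Fin d → ℤ) → ℝ :=
  fun y => if y = x then t else if h : y ∈ Λ.erase x then ψ ⟨y, h⟩ else 0

/-- The (unnormalized) density of `φ_x` under `μ_Λ( · | |φ_z| ≤ a ∀ z ∈ A)`,
obtained by integrating out the coordinates in `Λ \ {x}` with `φ_x = t` fixed. -/
noncomputable def marginalDensity {d : ℕ} (p : (Fin d → ℤ) → ℝ) (V : ℝ → ℝ)
    (Λ : Finset (Fin d → ℤ)) (x : Fin d → ℤ) (a : ℝ) (A : Finset (Fin d → ℤ))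
    (t : ℝ) : ℝ :=
  ∫ ψ : {z // z ∈ Λ.erase x} → ℝ
      in {ψ | ∀ z ∈ A, |extendAt Λ x t ψ z| ≤ a},
    Real.exp (-(hamiltonian p V Λ (extendAt Λ x t ψ)))

open scoped ENNReal

theorem bm_compact (A B C : Set ℝ) (hA : IsCompact A) (hB : IsCompact B) (hA0 : A.Nonempty)
    (hB0 : B.Nonempty) (h : ∀ x ∈ A, ∀ y ∈ B, (x + y) / 2 ∈ C) :
    volume A + volume B ≤ 2 * volume C := by
  obtain ⟨α, hα⟩ := hA.exists_isGreatest hA0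
  obtain ⟨β, hβ⟩ := hB.exists_isLeast hB0
  set C' : Set ℝ := (fun z => (2⁻¹ : ℝ) * z) ⁻¹' C with hC'
  have hvol : volume C' = 2 * volume C := by
    rw [hC', Real.volume_preimage_mul_left (by norm_num)]
    norm_num
  have h1 : volume A ≤ volume (C' ∩ Set.Iic (α + β)) := by
    rw [← measure_preimage_add_right volume β (C' ∩ Set.Iic (α + β))]
    apply measure_mono
    intro x hx
    refine ⟨?_, ?_⟩
    · have := h x hx β hβ.1
      simpa [hC', div_eq_inv_mul] using this
    · have := hα.2 hx
      simpa using this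
  have h2 : volume B ≤ volume (C' ∩ Set.Ici (α + β)) := by
    rw [← measure_preimage_add volume α (C' ∩ Set.Ici (α + β))]
    apply measure_mono
    intro x hx
    refine ⟨?_, ?_⟩
    · have := h α hα.1 x hx
      simpa [hC', div_eq_inv_mul] using this
    · have := hβ.2 hx
      simpa using this
  have h3 : volume (C' ∩ Set.Ici (α + β)) = volume (C' \ Set.Iic (α + β)) := by
    rw [Set.sdiff_eq, Set.compl_Iic]
    exact measure_congr ((ae_eq_refl _).inter Ioi_ae_eq_Ici.symm)
  rw [← hvol, ← measure_inter_add_sdiff C' (measurableSet_Iic (a := α + β)), ← h3]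
  exact add_le_add h1 h2

theorem bm_meas (A B C : Set ℝ) (hA : MeasurableSet A) (hB : MeasurableSet B) (hA0 : A.Nonempty)
    (hB0 : B.Nonempty) (h : ∀ x ∈ A, ∀ y ∈ B, (x + y) / 2 ∈ C) :
    volume A + volume B ≤ 2 * volume C := by
  obtain ⟨a, ha⟩ := hA0
  obtain ⟨b, hb⟩ := hB0
  rw [hA.measure_eq_iSup_isCompact, hB.measure_eq_iSup_isCompact]
  simp only [iSup_and']
  refine ENNReal.biSup_add_biSup_le' ⟨∅, by simp⟩ ⟨∅, by simp⟩ ?_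
  rintro K ⟨hK, hKc⟩ L ⟨hL, hLc⟩
  refine le_trans (add_le_add (measure_mono (Set.subset_insert a K))
    (measure_mono (Set.subset_insert b L)))
    (bm_compact _ _ C (hKc.insert a) (hLc.insert b) ⟨a, by simp⟩ ⟨b, by simp⟩ ?_)
  intro x hx y hy
  exact h x (Set.insert_subset ha hK hx) y (Set.insert_subset hb hL hy)

theorem layer (f : ℝ → ℝ≥0∞) (hf : Measurable f) (h1 : ∀ x, f x ≤ 1) :
    ∫⁻ x, f x = ∫⁻ t in Set.Ioi (0:ℝ), volume {x | ENNReal.ofReal t < f x} := by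
  have hfin : ∀ x, f x ≠ ∞ := fun x => ne_top_of_le_ne_top (by simp) (h1 x)
  have := lintegral_eq_lintegral_meas_lt (volume : Measure ℝ) (f := fun x => (f x).toReal)
    (Filter.Eventually.of_forall fun x => ENNReal.toReal_nonneg) hf.ennreal_toReal.aemeasurable
  simp only [ENNReal.ofReal_toReal (hfin _)] at this
  rw [this]
  refine setLIntegral_congr_fun measurableSet_Ioi ?_
  intro t ht
  simp only [ENNReal.ofReal_lt_iff_lt_toReal (le_of_lt ht) (hfin _)]

theorem pl_core (f g h : ℝ → ℝ≥0∞) (hf : Measurable f) (hg : Measurable g) (hh : Measurable h)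
    (hf1 : ∀ x, f x ≤ 1) (hg1 : ∀ x, g x ≤ 1) (hfs : ∀ s < 1, ∃ x, s < f x)
    (hgs : ∀ s < 1, ∃ x, s < g x) (H : ∀ x y, f x * g y ≤ h ((x + y) / 2) ^ 2) :
    (∫⁻ x, f x) + (∫⁻ x, g x) ≤ 2 * ∫⁻ x, h x := by
  have hm : Measurable (fun x => min (h x) 1) := hh.min measurable_const
  have e : ∫⁻ x, min (h x) 1 ≤ ∫⁻ x, h x := lintegral_mono fun x => min_le_left _ _
  refine le_trans ?_ (mul_le_mul_right e 2)
  rw [layer f hf hf1, layer g hg hg1, layer _ hm (fun x => min_le_right _ _)]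
  have anti : ∀ k : ℝ → ℝ≥0∞, Measurable (fun t : ℝ => volume {x | ENNReal.ofReal t < k x}) := by
    intro k
    apply Antitone.measurable
    intro s t hst
    exact measure_mono fun x (hx : _ < _) => lt_of_le_of_lt (ENNReal.ofReal_le_ofReal hst) hx
  rw [← lintegral_add_left (anti f), ← lintegral_const_mul _ (anti _)]
  refine setLIntegral_mono' measurableSet_Ioi ?_
  intro t ht
  by_cases h1 : ENNReal.ofReal t < 1
  · refine bm_meas _ _ _ (measurableSet_lt measurable_const hf) (measurableSet_lt measurable_const hg)
      (hfs _ h1) (hgs _ h1) ?_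
    intro x hx y hy
    refine lt_min ?_ h1
    have : ENNReal.ofReal t ^ 2 < h ((x + y) / 2) ^ 2 := by
      refine lt_of_lt_of_le ?_ (H x y)
      rw [sq]
      exact ENNReal.mul_lt_mul hx hy
    by_contra hcon
    exact absurd this (not_lt.2 (pow_le_pow_left' (not_lt.1 hcon) 2))
  · have z : ∀ k : ℝ → ℝ≥0∞, (∀ x, k x ≤ 1) → {x | ENNReal.ofReal t < k x} = ∅ := by
      intro k hk
      ext x
      simpa using (hk x).trans (not_lt.1 h1)
    simp [z f hf1, z g hg1]

theorem amgm (x y : ℝ≥0∞) : 4 * (x * y) ≤ (x + y) ^ 2 := by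
  by_cases hx : x = ∞
  · simp [hx]
  by_cases hy : y = ∞
  · simp [hy]
  lift x to NNReal using hx
  lift y to NNReal using hy
  norm_cast
  rw [← NNReal.coe_le_coe]
  push_cast
  nlinarith [sq_nonneg ((x:ℝ) - y)]

theorem pl_bdd (f g h : ℝ → ℝ≥0∞) (hf : Measurable f) (hg : Measurable g) (hh : Measurable h)
    (M : NNReal) (hf1 : ∀ x, f x ≤ M) (hg1 : ∀ x, g x ≤ M)
    (H : ∀ x y, f x * g y ≤ h ((x + y) / 2) ^ 2) :
    (∫⁻ x, f x) * ∫⁻ x, g x ≤ (∫⁻ x, h x) ^ 2 := by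
  obtain ⟨a, ha⟩ : ∃ a : NNReal, (a : ℝ≥0∞) = ⨆ x, f x := by
    have : (⨆ x, f x) ≠ ∞ := ne_top_of_le_ne_top (by simp) (iSup_le hf1)
    exact ⟨_, ENNReal.coe_toNNReal this⟩
  obtain ⟨b, hb⟩ : ∃ b : NNReal, (b : ℝ≥0∞) = ⨆ x, g x := by
    have : (⨆ x, g x) ≠ ∞ := ne_top_of_le_ne_top (by simp) (iSup_le hg1)
    exact ⟨_, ENNReal.coe_toNNReal this⟩
  by_cases ha0 : a = 0
  · have : ∀ x, f x = 0 := by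
      simpa [ha0, eq_comm] using ha
    simp [this]
  by_cases hb0 : b = 0
  · have : ∀ x, g x = 0 := by
      simpa [hb0, eq_comm] using hb
    simp [this]
  have key : ∀ (k : ℝ → ℝ≥0∞) (c : NNReal), c ≠ 0 → (c : ℝ≥0∞) = ⨆ x, k x →
      (∀ x, (c : ℝ≥0∞)⁻¹ * k x ≤ 1) ∧ ∀ s < 1, ∃ x, s < (c : ℝ≥0∞)⁻¹ * k x := by
    intro k c hc0 hc
    have c0 : (c : ℝ≥0∞) ≠ 0 := by simpa using hc0
    constructor
    · intro x
      rw [← ENNReal.inv_mul_cancel c0 ENNReal.coe_ne_top]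
      exact mul_le_mul_right (hc ▸ le_iSup k x) _
    · intro s hs
      have : (c : ℝ≥0∞) * s < ⨆ x, k x := by
        rw [← hc]
        conv_rhs => rw [← mul_one (c : ℝ≥0∞)]
        exact (ENNReal.mul_lt_mul_iff_right c0 ENNReal.coe_ne_top).2 hs
      obtain ⟨x, hx⟩ := lt_iSup_iff.1 this
      refine ⟨x, ?_⟩
      rw [← ENNReal.mul_lt_mul_iff_right c0 ENNReal.coe_ne_top, ← mul_assoc,
        ENNReal.mul_inv_cancel c0 ENNReal.coe_ne_top, one_mul]
      exact hx
  set c : NNReal := NNReal.sqrt (a * b) with hc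
  have hc2 : c ^ 2 = a * b := NNReal.sq_sqrt _
  have hc0 : c ≠ 0 := by
    intro h0
    rw [h0] at hc2
    simp [ha0, hb0] at hc2
  have a0 : (a : ℝ≥0∞) ≠ 0 := by simpa using ha0
  have b0 : (b : ℝ≥0∞) ≠ 0 := by simpa using hb0
  have c0 : (c : ℝ≥0∞) ≠ 0 := by simpa using hc0
  have hc2' : (a : ℝ≥0∞)⁻¹ * (b : ℝ≥0∞)⁻¹ = ((c : ℝ≥0∞)⁻¹) ^ 2 := by
    rw [← ENNReal.coe_inv ha0, ← ENNReal.coe_inv hb0, ← ENNReal.coe_inv hc0]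
    norm_cast
    rw [inv_pow, hc2, mul_inv]
  have core := pl_core (fun x => (a : ℝ≥0∞)⁻¹ * f x) (fun x => (b : ℝ≥0∞)⁻¹ * g x)
    (fun x => (c : ℝ≥0∞)⁻¹ * h x) (hf.const_mul _) (hg.const_mul _) (hh.const_mul _)
    (key f a ha0 ha).1 (key g b hb0 hb).1 (key f a ha0 ha).2 (key g b hb0 hb).2 (by
      intro x y
      rw [mul_pow, ← hc2', mul_mul_mul_comm]
      exact mul_le_mul_right (H x y) _)
  rw [lintegral_const_mul _ hf, lintegral_const_mul _ hg, lintegral_const_mul _ hh] at core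
  have := (amgm _ _).trans (pow_le_pow_left' core 2)
  rw [mul_mul_mul_comm, hc2', mul_pow, mul_pow, ← mul_assoc, ← mul_assoc ((2 : ℝ≥0∞) ^ 2)] at this
  have e4 : (2 : ℝ≥0∞) ^ 2 = 4 := by norm_num
  rw [e4, ENNReal.mul_le_mul_iff_right] at this
  · exact this
  · simp
  · exact ENNReal.mul_ne_top (by simp) (by simp [c0])

theorem pl_one (f g h : ℝ → ℝ≥0∞) (hf : Measurable f) (hg : Measurable g) (hh : Measurable h)
    (H : ∀ x y, f x * g y ≤ h ((x + y) / 2) ^ 2) :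
    (∫⁻ x, f x) * ∫⁻ x, g x ≤ (∫⁻ x, h x) ^ 2 := by
  have tr : ∀ k : ℝ → ℝ≥0∞, Measurable k →
      ∫⁻ x, k x = ⨆ n : ℕ, ∫⁻ x, min (k x) n := by
    intro k hk
    rw [← lintegral_iSup (fun n => hk.min measurable_const)]
    · congr 1
      ext x
      rw [← inf_iSup_eq, ENNReal.iSup_natCast]
      simp
    · intro m n hmn x
      exact min_le_min le_rfl (by exact_mod_cast hmn)
  rw [tr f hf, tr g hg, ENNReal.iSup_mul]
  refine iSup_le fun m => ?_
  rw [ENNReal.mul_iSup]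
  refine iSup_le fun n => ?_
  refine pl_bdd _ _ h (hf.min measurable_const) (hg.min measurable_const) hh (max m n : NNReal)
    ?_ ?_ ?_
  · intro x
    refine (min_le_right _ _).trans ?_
    exact_mod_cast le_max_left _ _
  · intro x
    refine (min_le_right _ _).trans ?_
    exact_mod_cast le_max_right _ _
  · intro x y
    exact (mul_le_mul' (min_le_left _ _) (min_le_left _ _)).trans (H x y)

theorem pl_fin (n : ℕ) : ∀ (f g h : (Fin n → ℝ) → ℝ≥0∞), Measurable f → Measurable g →
    Measurable h → (∀ x y, f x * g y ≤ h (fun i => (x i + y i) / 2) ^ 2) →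
    (∫⁻ x, f x) * ∫⁻ x, g x ≤ (∫⁻ x, h x) ^ 2 := by
  induction n with
  | zero =>
    intro f g h hf hg hh H
    have e : ∀ k : (Fin 0 → ℝ) → ℝ≥0∞, ∫⁻ x, k x = k default := by
      intro k
      rw [lintegral_unique]
      simp [volume_pi]
      congr 1
      exact Subsingleton.elim _ _
    rw [e, e, e]
    convert H default default
  | succ n ih =>
    intro f g h hf hg hh H
    let e := (MeasurableEquiv.piFinSuccAbove (fun _ : Fin (n+1) => ℝ) 0).symm
    have mp : MeasurePreserving e volume volume :=
      (volume_preserving_piFinSuccAbove (fun _ : Fin (n+1) => ℝ) 0).symm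
    have he : ∀ k : (Fin (n+1) → ℝ) → ℝ≥0∞, Measurable k →
        ∫⁻ x, k x = ∫⁻ s : ℝ, ∫⁻ y : Fin n → ℝ, k (e (s, y)) := by
      intro k hk
      rw [← mp.lintegral_comp hk]
      exact lintegral_prod _ (hk.comp e.measurable).aemeasurable
    rw [he f hf, he g hg, he h hh]
    have hm : ∀ k : (Fin (n+1) → ℝ) → ℝ≥0∞, Measurable k →
        Measurable fun s : ℝ => ∫⁻ y : Fin n → ℝ, k (e (s, y)) := by
      intro k hk
      exact (hk.comp e.measurable).lintegral_prod_right'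
    refine pl_one _ _ _ (hm f hf) (hm g hg) (hm h hh) ?_
    intro s t
    have hm2 : ∀ (k : (Fin (n+1) → ℝ) → ℝ≥0∞) (s : ℝ), Measurable k →
        Measurable fun y : Fin n → ℝ => k (e (s, y)) := by
      intro k s hk
      exact hk.comp (e.measurable.comp measurable_prodMk_left)
    refine ih _ _ _ (hm2 f s hf) (hm2 g t hg) (hm2 h _ hh) ?_
    intro x y
    convert H (e (s, x)) (e (t, y)) using 3
    ext i
    refine Fin.cases ?_ (fun j => ?_) i <;>
      simp [e, MeasurableEquiv.piFinSuccAbove, Fin.insertNthEquiv]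

theorem pl_pi {ι : Type*} [Fintype ι] (f g h : (ι → ℝ) → ℝ≥0∞) (hf : Measurable f)
    (hg : Measurable g) (hh : Measurable h)
    (H : ∀ x y, f x * g y ≤ h (fun i => (x i + y i) / 2) ^ 2) :
    (∫⁻ x, f x) * ∫⁻ x, g x ≤ (∫⁻ x, h x) ^ 2 := by
  let e := MeasurableEquiv.piCongrLeft (fun _ : ι => ℝ) (Fintype.equivFin ι).symm
  have mp : MeasurePreserving e volume volume :=
    volume_measurePreserving_piCongrLeft (fun _ : ι => ℝ) (Fintype.equivFin ι).symm
  rw [← mp.lintegral_comp hf, ← mp.lintegral_comp hg, ← mp.lintegral_comp hh]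
  refine pl_fin _ _ _ _ (hf.comp e.measurable) (hg.comp e.measurable) (hh.comp e.measurable) ?_
  intro x y
  convert H (e x) (e y) using 3
  ext i
  obtain ⟨j, rfl⟩ := (Fintype.equivFin ι).symm.surjective i
  simp [e, MeasurableEquiv.piCongrLeft, Equiv.piCongrLeft_apply_apply]

theorem summ_p {d : ℕ} (p : (Fin d → ℤ) → ℝ) (hs : Summable p)
    (hp_nonneg : ∀ x, 0 ≤ p x)
    (Λ : Finset (Fin d → ℤ)) :
    Summable fun q : (Fin d → ℤ) × (Fin d → ℤ) =>
      if q.1 ∈ Λ ∨ q.2 ∈ Λ then p (q.1 - q.2) else 0 := by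
  have h1 : ∀ z ∈ Λ, Summable fun q : (Fin d → ℤ) × (Fin d → ℤ) =>
      if q.1 = z then p (q.1 - q.2) else 0 := by
    intro z _
    have inj : Function.Injective (fun y : Fin d → ℤ => (z, y)) := fun a b h => by simpa using h
    rw [← inj.summable_iff]
    · have := (Equiv.subLeft z).summable_iff.2 hs
      simpa [Function.comp_def] using this
    · rintro ⟨u, v⟩ hq
      have : u ≠ z := by
        rintro rfl
        exact hq ⟨v, rfl⟩
      simp [this]
  have h2 : ∀ z ∈ Λ, Summable fun q : (Fin d → ℤ) × (Fin d → ℤ) =>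
      if q.2 = z then p (q.1 - q.2) else 0 := by
    intro z _
    have inj : Function.Injective (fun y : Fin d → ℤ => (y, z)) := fun a b h => by simpa using h
    rw [← inj.summable_iff]
    · have := (Equiv.subRight z).summable_iff.2 hs
      simpa [Function.comp_def] using this
    · rintro ⟨u, v⟩ hq
      have : v ≠ z := by
        rintro rfl
        exact hq ⟨u, rfl⟩
      simp [this]
  refine Summable.of_nonneg_of_le ?_ ?_ ((summable_sum h1).add (summable_sum h2))
  · intro q
    split_ifs
    · exact hp_nonneg _
    · exact le_rfl
  · intro q
    have := hp_nonneg (q.1 - q.2)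
    simp only [Finset.sum_ite_eq]
    split_ifs <;> first | linarith | tauto

theorem summ_H {d : ℕ} (p : (Fin d → ℤ) → ℝ) (V : ℝ → ℝ) (hs : Summable p)
    (hp_nonneg : ∀ x, 0 ≤ p x) (hV : Continuous V)
    (Λ : Finset (Fin d → ℤ)) (ψ : (Fin d → ℤ) → ℝ) (hψ : ∀ y, y ∉ Λ → ψ y = 0) :
    Summable fun q : (Fin d → ℤ) × (Fin d → ℤ) =>
      if q.1 ∈ Λ ∨ q.2 ∈ Λ then p (q.1 - q.2) * V (ψ q.1 - ψ q.2) else 0 := by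
  set K := ∑ z ∈ Λ, |ψ z| with hK
  have hK0 : 0 ≤ K := Finset.sum_nonneg fun _ _ => abs_nonneg _
  have hb : ∀ y, |ψ y| ≤ K := by
    intro y
    by_cases hy : y ∈ Λ
    · exact Finset.single_le_sum (f := fun z => |ψ z|) (fun _ _ => abs_nonneg _) hy
    · simpa [hψ y hy] using hK0
  obtain ⟨M, hM⟩ := (isCompact_Icc (a := -(2 * K)) (b := 2 * K)).exists_bound_of_continuousOn
    hV.continuousOn
  refine Summable.of_norm_bounded ((summ_p p hs hp_nonneg Λ).mul_right M) ?_
  intro q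
  split_ifs with h
  · rw [norm_mul, Real.norm_of_nonneg (hp_nonneg _)]
    refine mul_le_mul_of_nonneg_left (hM _ ?_) (hp_nonneg _)
    have h1 := abs_le.1 (hb q.1)
    have h2 := abs_le.1 (hb q.2)
    constructor <;> linarith
  · simp

theorem H_convex {d : ℕ} (p : (Fin d → ℤ) → ℝ) (V : ℝ → ℝ) (hs : Summable p)
    (hp_nonneg : ∀ x, 0 ≤ p x) (hV : Continuous V) (hc : ConvexOn ℝ Set.univ V)
    (Λ : Finset (Fin d → ℤ)) (ψ₁ ψ₂ : (Fin d → ℤ) → ℝ) (h₁ : ∀ y, y ∉ Λ → ψ₁ y = 0)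
    (h₂ : ∀ y, y ∉ Λ → ψ₂ y = 0) (a b : ℝ) (ha : 0 ≤ a) (hb : 0 ≤ b) (hab : a + b = 1) :
    hamiltonian p V Λ (a • ψ₁ + b • ψ₂) ≤
      a * hamiltonian p V Λ ψ₁ + b * hamiltonian p V Λ ψ₂ := by
  have s1 := summ_H p V hs hp_nonneg hV Λ ψ₁ h₁
  have s2 := summ_H p V hs hp_nonneg hV Λ ψ₂ h₂
  have s3 := summ_H p V hs hp_nonneg hV Λ (a • ψ₁ + b • ψ₂)
    (fun y hy => by simp [h₁ y hy, h₂ y hy])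
  have key := Summable.tsum_le_tsum (f := fun q : (Fin d → ℤ) × (Fin d → ℤ) =>
      if q.1 ∈ Λ ∨ q.2 ∈ Λ then
        p (q.1 - q.2) * V ((a • ψ₁ + b • ψ₂) q.1 - (a • ψ₁ + b • ψ₂) q.2) else 0) ?_ s3
    ((s1.mul_left a).add (s2.mul_left b))
  · rw [Summable.tsum_add (s1.mul_left a) (s2.mul_left b), tsum_mul_left, tsum_mul_left] at key
    unfold hamiltonian
    linarith
  · intro q
    split_ifs
    · have := hc.2 (Set.mem_univ (ψ₁ q.1 - ψ₁ q.2)) (Set.mem_univ (ψ₂ q.1 - ψ₂ q.2)) ha hb hab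
      have e : (a • ψ₁ + b • ψ₂) q.1 - (a • ψ₁ + b • ψ₂) q.2 =
        a • (ψ₁ q.1 - ψ₁ q.2) + b • (ψ₂ q.1 - ψ₂ q.2) := by
        simp
        ring
      rw [e]
      have := mul_le_mul_of_nonneg_left this (hp_nonneg (q.1 - q.2))
      simp only [smul_eq_mul] at *
      linarith
    · simp

theorem H_even {d : ℕ} (p : (Fin d → ℤ) → ℝ) (V : ℝ → ℝ) (hV_even : ∀ t, V (-t) = V t)
    (Λ : Finset (Fin d → ℤ)) (ψ : (Fin d → ℤ) → ℝ) :
    hamiltonian p V Λ (-ψ) = hamiltonian p V Λ ψ := by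
  unfold hamiltonian
  have : ∀ q : (Fin d → ℤ) × (Fin d → ℤ), V ((-ψ) q.1 - (-ψ) q.2) = V (ψ q.1 - ψ q.2) := by
    intro q
    rw [← hV_even]
    congr 1
    simp
    ring
  simp only [this]

theorem extend_off {d : ℕ} (Λ : Finset (Fin d → ℤ)) (x : Fin d → ℤ) (hx : x ∈ Λ) (t : ℝ)
    (ψ : {z // z ∈ Λ.erase x} → ℝ) (y : Fin d → ℤ) (hy : y ∉ Λ) : extendAt Λ x t ψ y = 0 := by
  have h1 : y ≠ x := fun h => hy (h ▸ hx)
  simp [extendAt, h1, hy]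

theorem extend_comb {d : ℕ} (Λ : Finset (Fin d → ℤ)) (x : Fin d → ℤ) (t₁ t₂ : ℝ)
    (ψ₁ ψ₂ : {z // z ∈ Λ.erase x} → ℝ) (a b : ℝ) :
    extendAt Λ x (a * t₁ + b * t₂) (a • ψ₁ + b • ψ₂) =
      a • extendAt Λ x t₁ ψ₁ + b • extendAt Λ x t₂ ψ₂ := by
  ext y
  simp only [extendAt, Pi.add_apply, Pi.smul_apply, smul_eq_mul]
  split_ifs <;> simp

theorem extend_neg {d : ℕ} (Λ : Finset (Fin d → ℤ)) (x : Fin d → ℤ) (t : ℝ)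
    (ψ : {z // z ∈ Λ.erase x} → ℝ) :
    extendAt Λ x (-t) (-ψ) = -extendAt Λ x t ψ := by
  ext y
  simp only [extendAt, Pi.neg_apply]
  split_ifs <;> simp

/-- For an even convex `C²` interaction `V` and a symmetric probability
kernel `p`, the density of `φ_x` under the conditioned gradient measure attains its
maximum at `0`. -/
theorem marginal_density_max_at_zero {d : ℕ} (p : (Fin d → ℤ) → ℝ) (V : ℝ → ℝ)
    (hp_nonneg : ∀ x, 0 ≤ p x) (hp_symm : ∀ x, p (-x) = p x)
    (hp_sum : ∑' x, p x = 1)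
    (hV_even : ∀ t, V (-t) = V t) (hV_smooth : ContDiff ℝ 2 V)
    (hV''_nonneg : ∀ t, 0 ≤ iteratedDeriv 2 V t)
    (Λ : Finset (Fin d → ℤ)) (a : ℝ) (ha : 0 < a)
    (x : Fin d → ℤ) (hx : x ∈ Λ) (A : Finset (Fin d → ℤ))
    (hA : A ⊆ Λ.erase x) :
    ∀ t : ℝ, marginalDensity p V Λ x a A t ≤ marginalDensity p V Λ x a A 0 := by
  have hs : Summable p := by
    by_contra h
    rw [tsum_eq_zero_of_not_summable h] at hp_sum
    norm_num at hp_sum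
  have hVc : Continuous V := hV_smooth.continuous
  have hc : ConvexOn ℝ Set.univ V := by
    refine convexOn_univ_of_deriv2_nonneg (hV_smooth.differentiable (by norm_num)) ?_ ?_
    · exact hV_smooth.differentiable_deriv_two
    · intro t
      rw [← iteratedDeriv_eq_iterate]
      exact hV''_nonneg t
  set Hm : ℝ → ({z // z ∈ Λ.erase x} → ℝ) → ℝ :=
    fun t ψ => hamiltonian p V Λ (extendAt Λ x t ψ) with hHm
  have hconv : ∀ (t₁ t₂ : ℝ) (ψ₁ ψ₂ : {z // z ∈ Λ.erase x} → ℝ) (a b : ℝ), 0 ≤ a → 0 ≤ b →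
      a + b = 1 → Hm (a * t₁ + b * t₂) (a • ψ₁ + b • ψ₂) ≤ a * Hm t₁ ψ₁ + b * Hm t₂ ψ₂ := by
    intro t₁ t₂ ψ₁ ψ₂ a b ha hb hab
    simp only [hHm]
    rw [extend_comb]
    exact H_convex p V hs hp_nonneg hVc hc Λ _ _ (extend_off Λ x hx t₁ ψ₁)
      (extend_off Λ x hx t₂ ψ₂) a b ha hb hab
  have hcont : ∀ t, Continuous (Hm t) := by
    intro t
    have : ConvexOn ℝ Set.univ (Hm t) := by
      refine ⟨convex_univ, ?_⟩
      intro ψ₁ _ ψ₂ _ a b ha hb hab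
      have := hconv t t ψ₁ ψ₂ a b ha hb hab
      rw [← add_mul, hab, one_mul] at this
      exact this
    exact this.locallyLipschitz.continuous
  have hneg : ∀ t ψ, Hm (-t) (-ψ) = Hm t ψ := by
    intro t ψ
    simp only [hHm]
    rw [extend_neg, H_even p V hV_even]
  set S : Set ({z // z ∈ Λ.erase x} → ℝ) := {ψ | ∀ z (hz : z ∈ A), |ψ ⟨z, hA hz⟩| ≤ a} with hS
  have hSt : ∀ t, {ψ : {z // z ∈ Λ.erase x} → ℝ | ∀ z ∈ A, |extendAt Λ x t ψ z| ≤ a} = S := by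
    intro t
    ext ψ
    refine forall_congr' fun z => forall_congr' fun hz => ?_
    have h1 : z ≠ x := (Finset.mem_erase.1 (hA hz)).1
    have h2 := hA hz
    simp only [extendAt, h1, if_false, h2, dif_pos]
  have hSm : MeasurableSet S := by
    apply IsClosed.measurableSet
    simp only [hS, Set.ofPred_forall]
    refine isClosed_iInter fun z => isClosed_iInter fun hz => ?_
    exact isClosed_le (by fun_prop) continuous_const
  set D : ℝ → ({z // z ∈ Λ.erase x} → ℝ) → ℝ≥0∞ :=
    fun t ψ => ENNReal.ofReal (Real.exp (-(Hm t ψ))) with hD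
  have hDm : ∀ t, Measurable (D t) := fun t =>
    (ENNReal.measurable_ofReal.comp (Real.continuous_exp.comp (hcont t).neg).measurable)
  set L : ℝ → ℝ≥0∞ := fun t => ∫⁻ ψ, S.indicator (D t) ψ with hL
  have hF : ∀ t, marginalDensity p V Λ x a A t = (L t).toReal := by
    intro t
    unfold marginalDensity
    rw [hSt]
    change ∫ ψ in S, Real.exp ((-Hm t) ψ) = _
    rw [integral_eq_lintegral_of_nonneg_ae
      (Filter.Eventually.of_forall fun _ => (Real.exp_pos _).le)
      (Real.continuous_exp.comp (hcont t).neg).aestronglyMeasurable]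
    simp only [hL]
    rw [lintegral_indicator hSm]
    rfl
  have hPL : ∀ s u, L s * L u ≤ L ((s + u) / 2) ^ 2 := by
    intro s u
    refine pl_pi _ _ _ ((hDm s).indicator hSm) ((hDm u).indicator hSm)
      ((hDm _).indicator hSm) ?_
    intro ψ₁ ψ₂
    by_cases m1 : ψ₁ ∈ S
    swap
    · simp [m1]
    by_cases m2 : ψ₂ ∈ S
    swap
    · simp [m2]
    have m3 : (fun i => (ψ₁ i + ψ₂ i) / 2) ∈ S := by
      intro z hz
      have h1 := abs_le.1 (m1 z hz)
      have h2 := abs_le.1 (m2 z hz)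
      exact abs_le.2 ⟨by linarith, by linarith⟩
    rw [Set.indicator_of_mem m1, Set.indicator_of_mem m2, Set.indicator_of_mem m3]
    simp only [hD]
    rw [← ENNReal.ofReal_mul (Real.exp_pos _).le, ← ENNReal.ofReal_pow (Real.exp_pos _).le,
      ← Real.exp_add, ← Real.exp_nat_mul]
    apply ENNReal.ofReal_le_ofReal
    apply Real.exp_le_exp.2
    have := hconv s u ψ₁ ψ₂ (1/2) (1/2) (by norm_num) (by norm_num) (by norm_num)
    have e1 : (1/2 : ℝ) * s + 1/2 * u = (s + u) / 2 := by ring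
    have e2 : (1/2 : ℝ) • ψ₁ + (1/2 : ℝ) • ψ₂ = fun i => (ψ₁ i + ψ₂ i) / 2 := by
      ext i
      simp
      ring
    rw [e1, e2] at this
    push_cast
    linarith
  have hLneg : ∀ t, L (-t) = L t := by
    intro t
    simp only [hL]
    rw [← lintegral_neg_eq_self]
    congr 1
    ext ψ
    have hm : -ψ ∈ S ↔ ψ ∈ S := by simp [hS]
    by_cases m : ψ ∈ S
    · rw [Set.indicator_of_mem m, Set.indicator_of_mem (hm.2 m)]
      simp only [hD, hneg]
    · rw [Set.indicator_of_notMem m, Set.indicator_of_notMem (fun h => m (hm.1 h))]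
  have hLpos : ∀ t, L t ≠ 0 := by
    intro t
    simp only [hL]
    rw [lintegral_indicator hSm, ← pos_iff_ne_zero, setLIntegral_pos_iff (hDm t)]
    have : Function.support (D t) = Set.univ := by
      ext ψ
      simp [hD, Real.exp_pos]
    rw [this, Set.univ_inter]
    refine lt_of_lt_of_le (Metric.measure_ball_pos volume 0 ha) (measure_mono ?_)
    intro ψ hψ z hz
    rw [mem_ball_zero_iff] at hψ
    exact (norm_le_pi_norm ψ ⟨z, hA hz⟩).trans hψ.le
  intro t
  rw [hF, hF]
  by_cases h0 : L 0 = ∞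
  · have h := hPL 0 (2 * t)
    rw [h0, ENNReal.top_mul (hLpos _)] at h
    have e : (0 + 2 * t) / 2 = t := by ring
    rw [e] at h
    have : L t = ∞ := by simpa using h
    rw [this, h0]
  · apply ENNReal.toReal_mono h0
    have h := hPL t (-t)
    rw [hLneg, add_neg_cancel, zero_div, ← sq] at h
    exact (ENNReal.pow_le_pow_left_iff two_ne_zero).1 h
end

section
/- Let p be a symmetric probability distribution on ℤ^d with Σ_x p(x) e^{a|x|} < ∞ for some a > 0, mean zero, and covariance Q. Then there exists η > 0 such that for |x/n| < η, p_n(x) = ((2πn)^{-d/2} (det Q(x/n))^{-1/2} + O(n^{-(d+1)/2})) · exp[−n I(x/n)], where ξ ↦ Q(ξ) and ξ ↦ I(ξ) are analytic in a neighborhood of 0 with Q(0) = Q, I(0) = 0, ∇I(0) = 0, ∇²I(0) = Q^{-1}. -/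
open Finset Matrix

/-- `n`-step distribution (convolution powers) of the step distribution `p` on `ℤ^d`. -/
noncomputable def convPowD {d : ℕ} (p : (Fin d → ℤ) → ℝ) : ℕ → (Fin d → ℤ) → ℝ
  | 0 => fun x => if x = 0 then 1 else 0
  | n + 1 => fun x => ∑' y, convPowD p n y * p (x - y)

/-- A point of `ℤ^d` as a real vector. -/
noncomputable def castV {d : ℕ} (x : Fin d → ℤ) : Fin d → ℝ := fun i => (x i : ℝ)


open MeasureTheory in
lemma dot_bound {d : ℕ} (u v : Fin d → ℝ) : |u ⬝ᵥ v| ≤ d * ‖u‖ * ‖v‖ := by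
  unfold dotProduct
  calc |∑ i, u i * v i| ≤ ∑ i, |u i * v i| := Finset.abs_sum_le_sum_abs _ _
    _ ≤ ∑ _i : Fin d, ‖u‖ * ‖v‖ := by
        refine Finset.sum_le_sum fun i _ => ?_
        rw [abs_mul]
        exact mul_le_mul (norm_le_pi_norm u i) (norm_le_pi_norm v i) (abs_nonneg _) (norm_nonneg _)
    _ = d * ‖u‖ * ‖v‖ := by simp; ring

lemma castV_add {d : ℕ} (x y : Fin d → ℤ) : castV (x + y) = castV x + castV y := by
  ext i; simp [castV]

lemma castV_sub {d : ℕ} (x y : Fin d → ℤ) : castV (x - y) = castV x - castV y := by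
  ext i; simp [castV]

/-- characters -/
noncomputable def chr {d : ℕ} (θ : Fin d → ℝ) (x : Fin d → ℤ) : ℂ :=
  Complex.exp (((θ ⬝ᵥ castV x : ℝ) : ℂ) * Complex.I)

lemma chr_norm {d : ℕ} (θ : Fin d → ℝ) (x : Fin d → ℤ) : ‖chr θ x‖ = 1 := by
  unfold chr; exact Complex.norm_exp_ofReal_mul_I _

lemma chr_add {d : ℕ} (θ : Fin d → ℝ) (x y : Fin d → ℤ) : chr θ (x + y) = chr θ x * chr θ y := by
  unfold chr; rw [← Complex.exp_add, castV_add, dotProduct_add]; push_cast; ring_nf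

lemma chr_zero {d : ℕ} (θ : Fin d → ℝ) : chr θ (0 : Fin d → ℤ) = 1 := by
  have : castV (0 : Fin d → ℤ) = 0 := by ext i; simp [castV]
  unfold chr; simp [this]

/-- characteristic function -/
noncomputable def chi {d : ℕ} (q : (Fin d → ℤ) → ℝ) (θ : Fin d → ℝ) : ℂ :=
  ∑' x, (q x : ℂ) * chr θ x

lemma conv_facts {d : ℕ} (a b : (Fin d → ℤ) → ℝ) (ha : ∀ x, 0 ≤ a x) (hb : ∀ x, 0 ≤ b x)
    (sa : Summable a) (sb : Summable b) :
    Summable (fun x => ∑' y, a y * b (x - y)) ∧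
    ∀ θ, chi (fun x => ∑' y, a y * b (x - y)) θ = chi a θ * chi b θ := by
  let e : (Fin d → ℤ) × (Fin d → ℤ) ≃ (Fin d → ℤ) × (Fin d → ℤ) :=
    { toFun := fun z => (z.2, z.1 - z.2)
      invFun := fun z => (z.1 + z.2, z.1)
      left_inv := fun z => by ext <;> simp
      right_inv := fun z => by ext <;> simp }
  have s1 : Summable (fun z : (Fin d → ℤ) × (Fin d → ℤ) => a z.1 * b z.2) :=
    sa.mul_of_nonneg sb ha hb
  have s2 : Summable (fun z : (Fin d → ℤ) × (Fin d → ℤ) => a z.2 * b (z.1 - z.2)) :=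
    (e.summable_iff (f := fun z : (Fin d → ℤ) × (Fin d → ℤ) => a z.1 * b z.2)).2 s1
  refine ⟨s2.prod, fun θ => ?_⟩
  unfold chi
  have sna : Summable fun x => ‖(a x : ℂ) * chr θ x‖ := by
    simp only [norm_mul, chr_norm, mul_one, Complex.norm_real]; exact sa.norm
  have snb : Summable fun x => ‖(b x : ℂ) * chr θ x‖ := by
    simp only [norm_mul, chr_norm, mul_one, Complex.norm_real]; exact sb.norm
  rw [tsum_mul_tsum_of_summable_norm sna snb]
  rw [← e.tsum_eq]
  have s3 : Summable (fun z : (Fin d → ℤ) × (Fin d → ℤ) =>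
      ((a (e z).1 : ℂ) * chr θ (e z).1) * ((b (e z).2 : ℂ) * chr θ (e z).2)) := by
    refine Summable.of_norm ?_
    simp only [norm_mul, chr_norm, mul_one, Complex.norm_real]
    simpa [e] using s2.norm
  rw [s3.tsum_prod]
  refine tsum_congr fun x => ?_
  push_cast
  rw [← tsum_mul_right]
  refine tsum_congr fun y => ?_
  have : chr θ x = chr θ y * chr θ (x - y) := by rw [← chr_add]; simp
  simp only [e, Equiv.coe_fn_mk]
  rw [this]; ring

lemma convPow_facts {d : ℕ} (q : (Fin d → ℤ) → ℝ) (hq : ∀ x, 0 ≤ q x) (sq : Summable q) (n : ℕ) :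
    (∀ x, 0 ≤ convPowD q n x) ∧ Summable (convPowD q n) ∧
    ∀ θ, chi (convPowD q n) θ = chi q θ ^ n := by
  induction n with
  | zero =>
    refine ⟨fun x => by simp only [convPowD]; split_ifs <;> norm_num, ?_, fun θ => ?_⟩
    · exact summable_of_ne_finset_zero (s := {0}) (fun x hx => by simp at hx; simp [convPowD, hx])
    · unfold chi
      rw [tsum_eq_single 0]
      · simp [convPowD, chr_zero]
      · intro x hx; simp [convPowD, hx]
  | succ n ih =>
    obtain ⟨h1, h2, h3⟩ := ih
    have := conv_facts _ q h1 hq h2 sq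
    refine ⟨fun x => tsum_nonneg fun y => mul_nonneg (h1 y) (hq _), this.1, fun θ => ?_⟩
    rw [pow_succ, ← h3 θ]
    exact this.2 θ

lemma convPow_tilt {d : ℕ} (p : (Fin d → ℤ) → ℝ) (l : Fin d → ℝ) (Z : ℝ) (n : ℕ) :
    ∀ x, convPowD (fun x => p x * Real.exp (l ⬝ᵥ castV x) / Z) n x
      = convPowD p n x * Real.exp (l ⬝ᵥ castV x) / Z ^ n := by
  induction n with
  | zero =>
    intro x
    by_cases hx : x = 0
    · have : castV (0 : Fin d → ℤ) = 0 := by ext i; simp [castV]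
      simp [convPowD, hx, this]
    · simp [convPowD, hx]
  | succ n ih =>
    intro x
    simp only [convPowD]
    rw [← tsum_mul_right, ← tsum_div_const]
    refine tsum_congr fun y => ?_
    rw [ih y]
    have : Real.exp (l ⬝ᵥ castV x) = Real.exp (l ⬝ᵥ castV y) * Real.exp (l ⬝ᵥ castV (x - y)) := by
      rw [← Real.exp_add, castV_sub, dotProduct_sub]; ring_nf
    rw [this, pow_succ]
    ring

/-- the Fourier box -/
def fbox (d : ℕ) : Set (Fin d → ℝ) := Set.univ.pi fun _ => Set.Ioc (-Real.pi) Real.pi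

open MeasureTheory in
lemma integral_chr {d : ℕ} (x : Fin d → ℤ) :
    ∫ θ in fbox d, chr θ x = if x = 0 then ((2 * Real.pi : ℝ) : ℂ) ^ d else 0 := by
  have h1 : ∀ θ : Fin d → ℝ, chr θ x = ∏ i, Complex.exp ((x i : ℂ) * Complex.I * (θ i : ℂ)) := by
    intro θ
    rw [← Complex.exp_sum]
    unfold chr dotProduct castV
    push_cast
    rw [Finset.sum_mul]
    congr 1
    exact Finset.sum_congr rfl fun i _ => by ring
  simp_rw [h1]
  unfold fbox
  rw [volume_pi, Measure.restrict_pi_pi,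
    integral_fintype_prod_eq_prod (f := fun i (t : ℝ) => Complex.exp ((x i : ℂ) * Complex.I * (t : ℂ)))]
  have h2 : ∀ k : ℤ, ∫ t in Set.Ioc (-Real.pi) Real.pi, Complex.exp ((k : ℂ) * Complex.I * (t : ℂ))
      = if k = 0 then ((2 * Real.pi : ℝ) : ℂ) else 0 := by
    intro k
    rw [← intervalIntegral.integral_of_le (by linarith [Real.pi_pos])]
    split_ifs with hk
    · simp [hk]; ring
    · rw [integral_exp_mul_complex (by simp [hk])]
      rw [div_eq_zero_iff]; left
      rw [sub_eq_zero, Complex.exp_eq_exp_iff_exists_int]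
      exact ⟨k, by push_cast; ring⟩
  simp_rw [h2]
  split_ifs with hx
  · simp [hx]
  · obtain ⟨i, hi⟩ := Function.ne_iff.1 hx
    exact Finset.prod_eq_zero (Finset.mem_univ i) (by simpa using hi)

lemma fbox_meas (d : ℕ) : MeasurableSet (fbox d) :=
  MeasurableSet.univ_pi fun _ => measurableSet_Ioc

open MeasureTheory in
lemma fbox_finite (d : ℕ) : IsFiniteMeasure (volume.restrict (fbox d)) := by
  refine ⟨?_⟩
  rw [Measure.restrict_apply_univ, fbox, Real.volume_pi_Ioc]
  exact ENNReal.prod_lt_top fun i _ => ENNReal.ofReal_lt_top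

lemma chr_cont {d : ℕ} (x : Fin d → ℤ) : Continuous fun θ : Fin d → ℝ => chr θ x := by
  unfold chr dotProduct; fun_prop

open MeasureTheory in
lemma fourier_inv {d : ℕ} (q : (Fin d → ℤ) → ℝ) (sq : Summable q) (x : Fin d → ℤ) :
    ∫ θ in fbox d, chi q θ * chr θ (-x) = (q x : ℂ) * ((2 * Real.pi : ℝ) : ℂ) ^ d := by
  have hf := fbox_finite d
  have h1 : ∀ θ : Fin d → ℝ, chi q θ * chr θ (-x) = ∑' y, (q y : ℂ) * chr θ (y - x) := by
    intro θ
    unfold chi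
    rw [← tsum_mul_right]
    refine tsum_congr fun y => ?_
    rw [sub_eq_add_neg, chr_add]; ring
  simp_rw [h1]
  have hn : ∀ (y : Fin d → ℤ) (θ : Fin d → ℝ), ‖(q y : ℂ) * chr θ (y - x)‖ = |q y| := by
    intro y θ; simp [chr_norm]
  have key := hasSum_integral_of_summable_integral_norm (μ := volume.restrict (fbox d))
    (F := fun (y : Fin d → ℤ) (θ : Fin d → ℝ) => (q y : ℂ) * chr θ (y - x)) ?_ ?_
  · rw [← key.tsum_eq]
    simp_rw [integral_const_mul, integral_chr]
    rw [tsum_eq_single x]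
    · simp
    · intro y hy; simp [sub_eq_zero, hy]
  · intro y
    refine Integrable.of_bound (C := |q y|) ?_ ?_
    · exact (continuous_const.mul (chr_cont _)).aestronglyMeasurable
    · exact Filter.Eventually.of_forall fun θ => (hn y θ).le
  · simp_rw [hn]
    simp only [integral_const]
    exact sq.abs.const_smul _

lemma taylor3 (t : ℝ) :
    ‖Complex.exp ((t : ℂ) * Complex.I) - 1 - (t : ℂ) * Complex.I + (t : ℂ) ^ 2 / 2‖ ≤ 4 * |t| ^ 3 := by
  by_cases h : |t| ≤ 1
  · have := Complex.exp_bound (x := (t : ℂ) * Complex.I) (by simpa using h) (n := 3) (by norm_num)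
    simp only [Finset.sum_range_succ, Finset.sum_range_zero, Nat.factorial, norm_mul,
      Complex.norm_I, mul_one, Complex.norm_real, Real.norm_eq_abs] at this
    have e : Complex.exp ((t : ℂ) * Complex.I) - 1 - (t : ℂ) * Complex.I + (t : ℂ) ^ 2 / 2
      = Complex.exp (↑t * Complex.I) - (0 + (↑t * Complex.I) ^ 0 / ((1:ℕ):ℂ) + (↑t * Complex.I) ^ 1 / (((0 + 1) * 1 : ℕ) :ℂ) +
          (↑t * Complex.I) ^ 2 / (((1+1)*((0 + 1) * 1) : ℕ) :ℂ)) := by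
      have : ((t:ℂ) * Complex.I) ^ 2 = - (t:ℂ)^2 := by rw [mul_pow, Complex.I_sq]; ring
      rw [this]; push_cast; ring
    rw [e]
    refine this.trans ?_
    have : 0 ≤ |t| ^ 3 := by positivity
    norm_num
    linarith
  · push Not at h
    have h1 : ‖Complex.exp ((t : ℂ) * Complex.I)‖ = 1 := Complex.norm_exp_ofReal_mul_I _
    have h2 : |t| ≤ |t| ^ 3 := by nlinarith [sq_nonneg (|t|), mul_pos (by linarith : 0 < |t|) (by linarith : 0 < |t|)]
    have h3 : |t| ^ 2 ≤ |t| ^ 3 := by nlinarith [sq_nonneg (|t|)]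
    calc _ ≤ ‖Complex.exp ((t : ℂ) * Complex.I)‖ + ‖(1 : ℂ)‖ + ‖(t : ℂ) * Complex.I‖ + ‖(t : ℂ) ^ 2 / 2‖ := by
            refine (norm_add_le _ _).trans (add_le_add_left ?_ _)
            refine (norm_sub_le _ _).trans (add_le_add_left ?_ _)
            exact norm_sub_le _ _
      _ = 1 + 1 + |t| + |t| ^ 2 / 2 := by rw [h1]; simp
      _ ≤ _ := by nlinarith

lemma exp_neg_taylor {u : ℝ} (hu : 0 ≤ u) : |Real.exp (-u) - (1 - u)| ≤ u ^ 2 := by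
  by_cases h : u ≤ 1
  · have := Real.abs_exp_sub_one_sub_id_le (x := -u) (by rw [abs_neg, abs_of_nonneg hu]; exact h)
    have e : Real.exp (-u) - (1 - u) = Real.exp (-u) - 1 - -u := by ring
    rw [e]; simpa using this
  · have h1 : Real.exp (-u) ≤ 1 := Real.exp_le_one_iff.2 (by linarith)
    have h2 := Real.add_one_le_exp (-u)
    rw [abs_le]; constructor <;> nlinarith

lemma pow_sub_pow_bound (z w : ℂ) (b : ℝ) (hb : 0 ≤ b) (hz : ‖z‖ ≤ b) (hw : ‖w‖ ≤ b) (n : ℕ) :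
    ‖z ^ (n+1) - w ^ (n+1)‖ ≤ (n+1) * b ^ n * ‖z - w‖ := by
  induction n with
  | zero => simp
  | succ n ih =>
    have e : z ^ (n+1+1) - w ^ (n+1+1) = z * (z ^ (n+1) - w ^ (n+1)) + (z - w) * w ^ (n+1) := by ring
    rw [e]
    refine (norm_add_le _ _).trans ?_
    rw [norm_mul, norm_mul, norm_pow]
    have h1 : ‖z‖ * ‖z ^ (n+1) - w ^ (n+1)‖ ≤ b * ((n+1) * b ^ n * ‖z - w‖) :=
      mul_le_mul hz ih (norm_nonneg _) hb
    have h2 : ‖z - w‖ * ‖w‖ ^ (n+1) ≤ ‖z - w‖ * b ^ (n+1) := by gcongr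
    push_cast
    calc _ ≤ _ := add_le_add h1 h2
      _ = _ := by ring

open MeasureTheory in
lemma gauss_integral {d : ℕ} (S : Matrix (Fin d) (Fin d) ℝ) (hS : S.PosDef) (t : ℝ) (ht : 0 < t) :
    ∫ θ : Fin d → ℝ, Real.exp (-(t * ((θ ⬝ᵥ S *ᵥ θ) / 2)))
      = (2 * Real.pi / t) ^ ((d : ℝ) / 2) * (Real.sqrt S.det)⁻¹ := by
  obtain ⟨B, hB⟩ : ∃ B : Matrix (Fin d) (Fin d) ℝ, S = Bᵀ * B := by
    open scoped MatrixOrder in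
    obtain ⟨B, hB⟩ := CStarAlgebra.nonneg_iff_eq_star_mul_self.mp hS.posSemidef.nonneg
    exact ⟨B, by rw [hB]; simp [Matrix.star_eq_conjTranspose, Matrix.conjTranspose_eq_transpose_of_trivial]⟩
  have hdet : S.det = B.det ^ 2 := by rw [hB, det_mul, det_transpose]; ring
  have hdet0 : B.det ≠ 0 := by
    intro h; have := hS.det_pos; rw [hdet, h] at this; norm_num at this
  have hsq : Real.sqrt S.det = |B.det| := by rw [hdet, Real.sqrt_sq_eq_abs]
  have hq : ∀ θ : Fin d → ℝ, θ ⬝ᵥ S *ᵥ θ = (B *ᵥ θ) ⬝ᵥ (B *ᵥ θ) := by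
    intro θ
    rw [hB, ← Matrix.mulVec_mulVec, Matrix.dotProduct_mulVec, Matrix.vecMul_transpose]
  let f : (Fin d → ℝ) → ℝ := fun v => Real.exp (-(t * ((v ⬝ᵥ v) / 2)))
  have hfc : Continuous f := by unfold f dotProduct; fun_prop
  have h1 : ∫ θ : Fin d → ℝ, Real.exp (-(t * ((θ ⬝ᵥ S *ᵥ θ) / 2))) = ∫ θ, f (toLin' B θ) := by
    refine integral_congr_ae (Filter.Eventually.of_forall fun θ => ?_)
    simp [f, hq]
  have hm : Measurable (toLin' B) := (LinearMap.continuous_of_finiteDimensional _).measurable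
  rw [h1, ← integral_map hm.aemeasurable hfc.aestronglyMeasurable,
    Real.map_matrix_volume_pi_eq_smul_volume_pi hdet0, integral_smul_measure]
  have h2 : ∀ v : Fin d → ℝ, f v = ∏ i, Real.exp (-(t/2) * (v i) ^ 2) := by
    intro v
    rw [← Real.exp_sum]
    unfold f dotProduct
    congr 1
    rw [← Finset.mul_sum]
    simp only [pow_two]
    ring
  simp_rw [h2]
  rw [integral_fintype_prod_volume_eq_pow (fun x : ℝ => Real.exp (-(t/2) * x ^ 2)), integral_gaussian,
    hsq, ENNReal.toReal_ofReal (abs_nonneg _), abs_inv, smul_eq_mul, mul_comm]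
  congr 1
  rw [Fintype.card_fin, Real.sqrt_eq_rpow, ← Real.rpow_natCast, ← Real.rpow_mul (by positivity)]
  congr 1
  · field_simp
  · ring

open MeasureTheory in
lemma h_integrable {d : ℕ} (hd : 0 < d) (c : ℝ) (hc : 0 < c) (k : ℕ) :
    Integrable (fun θ : Fin d → ℝ => ‖θ‖ ^ k * Real.exp (-(c * ‖θ‖ ^ 2))) := by
  have : Nonempty (Fin d) := ⟨⟨0, hd⟩⟩
  have := (integrable_fun_norm_addHaar (E := Fin d → ℝ) volume
    (f := fun r : ℝ => r ^ k * Real.exp (-(c * r ^ 2)))).2 ?_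
  · exact this
  · have h := integrableOn_rpow_mul_exp_neg_mul_sq hc (s := ((Module.finrank ℝ (Fin d → ℝ) - 1 + k : ℕ) : ℝ))
      (by have : (0:ℝ) ≤ ((Module.finrank ℝ (Fin d → ℝ) - 1 + k : ℕ) : ℝ) := Nat.cast_nonneg _
          linarith)
    refine h.congr_fun (fun r _ => ?_) measurableSet_Ioi
    simp only [Real.rpow_natCast, smul_eq_mul, pow_add]
    ring_nf

open MeasureTheory in
lemma h_scaling {d : ℕ} (c : ℝ) (n : ℕ) (hn : 1 ≤ n) :
    ∫ θ : Fin d → ℝ, ‖θ‖ ^ 3 * Real.exp (-(c * n * ‖θ‖ ^ 2))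
      = (n : ℝ) ^ (-(((d : ℝ) + 3) / 2)) * ∫ θ : Fin d → ℝ, ‖θ‖ ^ 3 * Real.exp (-(c * ‖θ‖ ^ 2)) := by
  have hn0 : (0 : ℝ) < n := by exact_mod_cast hn
  have := Measure.integral_comp_smul (volume : Measure (Fin d → ℝ))
    (fun θ : Fin d → ℝ => ‖θ‖ ^ 3 * Real.exp (-(c * ‖θ‖ ^ 2))) (Real.sqrt n)
  have h1 : ∀ θ : Fin d → ℝ, ‖Real.sqrt n • θ‖ ^ 3 * Real.exp (-(c * ‖Real.sqrt n • θ‖ ^ 2))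
      = (Real.sqrt n) ^ 3 * (‖θ‖ ^ 3 * Real.exp (-(c * n * ‖θ‖ ^ 2))) := by
    intro θ
    rw [norm_smul, Real.norm_of_nonneg (Real.sqrt_nonneg _), mul_pow, mul_pow, Real.sq_sqrt hn0.le]
    ring_nf
  simp_rw [h1] at this
  rw [integral_const_mul, smul_eq_mul] at this
  have h3 : 0 < Real.sqrt n := Real.sqrt_pos.2 hn0
  have h4 : ∫ θ : Fin d → ℝ, ‖θ‖ ^ 3 * Real.exp (-(c * n * ‖θ‖ ^ 2))
    = ((Real.sqrt n) ^ 3)⁻¹ * (|(Real.sqrt n ^ Module.finrank ℝ (Fin d → ℝ))⁻¹| * ∫ θ : Fin d → ℝ, ‖θ‖ ^ 3 * Real.exp (-(c * ‖θ‖ ^ 2))) := by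
    rw [← this, ← mul_assoc, inv_mul_cancel₀ (by positivity), one_mul]
  rw [h4, ← mul_assoc]
  congr 1
  rw [abs_of_pos (by positivity), ← mul_inv, ← pow_add, Module.finrank_fin_fun, Real.rpow_neg hn0.le]
  congr 1
  rw [Real.sqrt_eq_rpow, ← Real.rpow_natCast, ← Real.rpow_mul hn0.le]
  congr 1
  push_cast; ring

lemma first_moment {d : ℕ} (q : (Fin d → ℤ) → ℝ) (m : Fin d → ℝ) (hq1 : HasSum q 1)
    (hm : ∀ i, HasSum (fun x => q x * castV x i) (m i)) (θ : Fin d → ℝ) :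
    HasSum (fun x => q x * (θ ⬝ᵥ (castV x - m))) 0 := by
  have h1 : HasSum (fun x => ∑ i, θ i * (q x * castV x i)) (∑ i, θ i * m i) :=
    hasSum_sum fun i _ => (hm i).mul_left (θ i)
  have h2 := h1.sub (hq1.mul_right (θ ⬝ᵥ m))
  convert! h2 using 1
  · ext x
    rw [dotProduct_sub, mul_sub]
    congr 1
    unfold dotProduct
    rw [Finset.mul_sum]
    exact Finset.sum_congr rfl fun i _ => by ring
  · simp [dotProduct]

lemma second_moment {d : ℕ} (q : (Fin d → ℤ) → ℝ) (m : Fin d → ℝ)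
    (S : Matrix (Fin d) (Fin d) ℝ) (hq1 : HasSum q 1)
    (hm : ∀ i, HasSum (fun x => q x * castV x i) (m i))
    (hS : ∀ i j, HasSum (fun x => q x * (castV x i * castV x j)) (S i j + m i * m j))
    (θ : Fin d → ℝ) :
    HasSum (fun x => q x * (θ ⬝ᵥ (castV x - m)) ^ 2) (θ ⬝ᵥ S *ᵥ θ) := by
  have h1 : HasSum (fun x => ∑ i, ∑ j, θ i * θ j * (q x * (castV x i * castV x j)))
      (∑ i, ∑ j, θ i * θ j * (S i j + m i * m j)) :=
    hasSum_sum fun i _ => hasSum_sum fun j _ => (hS i j).mul_left _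
  have h3 := first_moment q m hq1 hm θ
  have h2 := (h1.sub (h3.mul_left (2 * (θ ⬝ᵥ m)))).sub (hq1.mul_right ((θ ⬝ᵥ m) ^ 2))
  convert! h2 using 1
  · ext x
    have : ∑ i, ∑ j, θ i * θ j * (q x * (castV x i * castV x j)) = q x * (θ ⬝ᵥ castV x) ^ 2 := by
      unfold dotProduct
      rw [pow_two, Finset.sum_mul_sum, Finset.mul_sum]
      refine Finset.sum_congr rfl fun i _ => ?_
      rw [Finset.mul_sum]
      exact Finset.sum_congr rfl fun j _ => by ring
    rw [this, dotProduct_sub]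
    ring
  · have : ∑ i, ∑ j, θ i * θ j * (S i j + m i * m j) = θ ⬝ᵥ S *ᵥ θ + (θ ⬝ᵥ m) ^ 2 := by
      unfold dotProduct mulVec dotProduct
      rw [pow_two, Finset.sum_mul_sum, ← Finset.sum_add_distrib]
      refine Finset.sum_congr rfl fun i _ => ?_
      rw [Finset.mul_sum, ← Finset.sum_add_distrib]
      exact Finset.sum_congr rfl fun j _ => by ring
    rw [this]; ring

lemma mean_bound {d : ℕ} (q : (Fin d → ℤ) → ℝ) (m : Fin d → ℝ) (M : ℝ)
    (hq0 : ∀ x, 0 ≤ q x)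
    (hm : ∀ i, HasSum (fun x => q x * castV x i) (m i))
    (hMs : Summable fun x => q x * (1 + ‖castV x‖) ^ 3)
    (hM : ∑' x, q x * (1 + ‖castV x‖) ^ 3 ≤ M) : 0 ≤ M ∧ ‖m‖ ≤ M := by
  have hM0 : 0 ≤ M := (tsum_nonneg fun x => mul_nonneg (hq0 x) (by positivity)).trans hM
  refine ⟨hM0, (pi_norm_le_iff_of_nonneg hM0).2 fun i => ?_⟩
  rw [← (hm i).tsum_eq]
  refine le_trans ?_ hM
  refine tsum_of_norm_bounded hMs.hasSum fun x => ?_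
  rw [norm_mul, Real.norm_of_nonneg (hq0 x)]
  refine mul_le_mul_of_nonneg_left ?_ (hq0 x)
  have h1 := norm_le_pi_norm (castV x) i
  have h2 := norm_nonneg (castV x)
  nlinarith [pow_nonneg h2 2, pow_nonneg h2 3]

lemma centered_third {d : ℕ} (q : (Fin d → ℤ) → ℝ) (m : Fin d → ℝ) (M : ℝ)
    (hq0 : ∀ x, 0 ≤ q x)
    (hm : ∀ i, HasSum (fun x => q x * castV x i) (m i))
    (hMs : Summable fun x => q x * (1 + ‖castV x‖) ^ 3)
    (hM : ∑' x, q x * (1 + ‖castV x‖) ^ 3 ≤ M) (θ : Fin d → ℝ) (k : ℕ) (hk : k ≤ 3) (x : Fin d → ℤ) :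
    q x * |θ ⬝ᵥ (castV x - m)| ^ k ≤ (d * ‖θ‖ * (1 + M)) ^ k * (q x * (1 + ‖castV x‖) ^ 3) := by
  obtain ⟨hM0, hmM⟩ := mean_bound q m M hq0 hm hMs hM
  have h2 := norm_nonneg (castV x)
  have h1 : ‖castV x - m‖ ≤ (1 + M) * (1 + ‖castV x‖) := by
    refine (norm_sub_le _ _).trans ?_
    nlinarith
  have h3 : |θ ⬝ᵥ (castV x - m)| ≤ (d * ‖θ‖ * (1 + M)) * (1 + ‖castV x‖) := by
    refine (dot_bound _ _).trans ?_
    rw [mul_assoc _ (1 + M)]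
    gcongr
  calc q x * |θ ⬝ᵥ (castV x - m)| ^ k
      ≤ q x * ((d * ‖θ‖ * (1 + M)) * (1 + ‖castV x‖)) ^ k := by
        gcongr; exact hq0 x
    _ = (d * ‖θ‖ * (1 + M)) ^ k * (q x * (1 + ‖castV x‖) ^ k) := by rw [mul_pow]; ring
    _ ≤ _ := by
        refine mul_le_mul_of_nonneg_left (mul_le_mul_of_nonneg_left ?_ (hq0 x)) (by positivity)
        exact pow_le_pow_right₀ (by linarith) hk

lemma chi_taylor {d : ℕ} (q : (Fin d → ℤ) → ℝ) (m : Fin d → ℝ)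
    (S : Matrix (Fin d) (Fin d) ℝ) (M : ℝ) (hq0 : ∀ x, 0 ≤ q x) (hq1 : HasSum q 1)
    (hm : ∀ i, HasSum (fun x => q x * castV x i) (m i))
    (hS : ∀ i j, HasSum (fun x => q x * (castV x i * castV x j)) (S i j + m i * m j))
    (hMs : Summable fun x => q x * (1 + ‖castV x‖) ^ 3)
    (hM : ∑' x, q x * (1 + ‖castV x‖) ^ 3 ≤ M) (θ : Fin d → ℝ) :
    ‖chi q θ * Complex.exp (((-(θ ⬝ᵥ m) : ℝ) : ℂ) * Complex.I)
      - ((1 - (θ ⬝ᵥ S *ᵥ θ) / 2 : ℝ) : ℂ)‖ ≤ 4 * (d * (1 + M)) ^ 3 * M * ‖θ‖ ^ 3 := by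
  have e1 : HasSum (fun x => (q x : ℂ) * Complex.exp (((θ ⬝ᵥ (castV x - m) : ℝ) : ℂ) * Complex.I))
      (chi q θ * Complex.exp (((-(θ ⬝ᵥ m) : ℝ) : ℂ) * Complex.I)) := by
    have : Summable fun x => (q x : ℂ) * chr θ x := by
      refine Summable.of_norm ?_
      simp only [norm_mul, chr_norm, mul_one, Complex.norm_real]
      exact hq1.summable.norm
    convert! this.hasSum.mul_right (Complex.exp (((-(θ ⬝ᵥ m) : ℝ) : ℂ) * Complex.I)) using 1
    ext x
    rw [mul_assoc, chr, ← Complex.exp_add, dotProduct_sub]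
    congr 2
    push_cast; ring
  have e2 : HasSum (fun x => (q x : ℂ)) 1 := by
    have := Complex.hasSum_ofReal.2 hq1
    rwa [Complex.ofReal_one] at this
  have e3 := Complex.hasSum_ofReal.2 (first_moment q m hq1 hm θ)
  have e4 := Complex.hasSum_ofReal.2 (second_moment q m S hq1 hm hS θ)
  have e5 := ((e1.sub e2).sub (e3.mul_right Complex.I)).add (e4.mul_right (1/2 : ℂ))
  have e6 : chi q θ * Complex.exp (((-(θ ⬝ᵥ m) : ℝ) : ℂ) * Complex.I)
      - ((1 - (θ ⬝ᵥ S *ᵥ θ) / 2 : ℝ) : ℂ) = chi q θ * Complex.exp (((-(θ ⬝ᵥ m) : ℝ) : ℂ) * Complex.I)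
      - 1 - ((0 : ℝ) : ℂ) * Complex.I + ((θ ⬝ᵥ S *ᵥ θ : ℝ) : ℂ) * (1/2 : ℂ) := by
    push_cast; ring
  rw [e6, ← e5.tsum_eq]
  have hb := hMs.mul_left (4 * (d * ‖θ‖ * (1 + M)) ^ 3)
  have : ‖∑' x, ((q x : ℂ) * Complex.exp (((θ ⬝ᵥ (castV x - m) : ℝ) : ℂ) * Complex.I) - (q x : ℂ)
      - ((q x * (θ ⬝ᵥ (castV x - m)) : ℝ) : ℂ) * Complex.I
      + ((q x * (θ ⬝ᵥ (castV x - m)) ^ 2 : ℝ) : ℂ) * (1/2 : ℂ))‖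
      ≤ ∑' x, 4 * (d * ‖θ‖ * (1 + M)) ^ 3 * (q x * (1 + ‖castV x‖) ^ 3) := by
    refine tsum_of_norm_bounded hb.hasSum fun x => ?_
    have h1 := taylor3 (θ ⬝ᵥ (castV x - m))
    have h2 := centered_third q m M hq0 hm hMs hM θ 3 le_rfl x
    have h3 : ((q x : ℂ) * Complex.exp (((θ ⬝ᵥ (castV x - m) : ℝ) : ℂ) * Complex.I) - (q x : ℂ)
      - ((q x * (θ ⬝ᵥ (castV x - m)) : ℝ) : ℂ) * Complex.I
      + ((q x * (θ ⬝ᵥ (castV x - m)) ^ 2 : ℝ) : ℂ) * (1/2 : ℂ))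
      = (q x : ℂ) * (Complex.exp (((θ ⬝ᵥ (castV x - m) : ℝ) : ℂ) * Complex.I) - 1
        - ((θ ⬝ᵥ (castV x - m) : ℝ) : ℂ) * Complex.I + ((θ ⬝ᵥ (castV x - m) : ℝ) : ℂ) ^ 2 / 2) := by
      push_cast; ring
    rw [h3, norm_mul, Complex.norm_real, Real.norm_of_nonneg (hq0 x)]
    calc _ ≤ q x * (4 * |θ ⬝ᵥ (castV x - m)| ^ 3) := mul_le_mul_of_nonneg_left h1 (hq0 x)
      _ = 4 * (q x * |θ ⬝ᵥ (castV x - m)| ^ 3) := by ring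
      _ ≤ 4 * _ := mul_le_mul_of_nonneg_left h2 (by norm_num)
      _ = _ := by ring
  refine this.trans ?_
  obtain ⟨hM0, -⟩ := mean_bound q m M hq0 hm hMs hM
  rw [tsum_mul_left]
  calc _ ≤ 4 * (d * ‖θ‖ * (1 + M)) ^ 3 * M := by gcongr
    _ = _ := by ring

lemma quad_upper {d : ℕ} (q : (Fin d → ℤ) → ℝ) (m : Fin d → ℝ)
    (S : Matrix (Fin d) (Fin d) ℝ) (M : ℝ) (hq0 : ∀ x, 0 ≤ q x) (hq1 : HasSum q 1)
    (hm : ∀ i, HasSum (fun x => q x * castV x i) (m i))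
    (hS : ∀ i j, HasSum (fun x => q x * (castV x i * castV x j)) (S i j + m i * m j))
    (hMs : Summable fun x => q x * (1 + ‖castV x‖) ^ 3)
    (hM : ∑' x, q x * (1 + ‖castV x‖) ^ 3 ≤ M) (θ : Fin d → ℝ) :
    θ ⬝ᵥ S *ᵥ θ ≤ (d * (1 + M)) ^ 2 * M * ‖θ‖ ^ 2 := by
  have h2 := second_moment q m S hq1 hm hS θ
  have h3 := hasSum_le (f := fun x => q x * (θ ⬝ᵥ (castV x - m)) ^ 2) (fun x => by
    rw [← sq_abs]
    exact centered_third q m M hq0 hm hMs hM θ 2 (by norm_num) x) h2 (hMs.mul_left _).hasSum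
  rw [tsum_mul_left] at h3
  refine h3.trans ?_
  calc _ ≤ (d * ‖θ‖ * (1 + M)) ^ 2 * M := by gcongr
    _ = _ := by ring

lemma quad_lower {d : ℕ} (q : (Fin d → ℤ) → ℝ) (m : Fin d → ℝ)
    (S : Matrix (Fin d) (Fin d) ℝ) (M c : ℝ) (hq0 : ∀ x, 0 ≤ q x) (hq1 : HasSum q 1)
    (hm : ∀ i, HasSum (fun x => q x * castV x i) (m i))
    (hS : ∀ i j, HasSum (fun x => q x * (castV x i * castV x j)) (S i j + m i * m j))
    (hMs : Summable fun x => q x * (1 + ‖castV x‖) ^ 3)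
    (hM : ∑' x, q x * (1 + ‖castV x‖) ^ 3 ≤ M) (hc : 0 < c)
    (hchi : ∀ θ : Fin d → ℝ, (∀ i, |θ i| ≤ Real.pi) → ‖chi q θ‖ ≤ Real.exp (-(c * ‖θ‖ ^ 2)))
    (θ : Fin d → ℝ) : c * ‖θ‖ ^ 2 ≤ (θ ⬝ᵥ S *ᵥ θ) / 2 := by
  set K := 4 * (d * (1 + M)) ^ 3 * M with hK
  set s := (θ ⬝ᵥ S *ᵥ θ) / 2 with hs
  have hev : ∀ᶠ t : ℝ in nhdsWithin 0 (Set.Ioi 0), c * ‖θ‖ ^ 2 ≤ s + t * (K * ‖θ‖ ^ 3) + t ^ 2 * (c * ‖θ‖ ^ 2) ^ 2 := by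
    have h1 : ∀ᶠ t : ℝ in nhdsWithin 0 (Set.Ioi 0), t * ‖θ‖ < Real.pi := by
      have : Filter.Tendsto (fun t : ℝ => t * ‖θ‖) (nhdsWithin 0 (Set.Ioi 0)) (nhds (0 * ‖θ‖)) :=
        ((continuous_id.mul continuous_const).tendsto 0).mono_left nhdsWithin_le_nhds
      rw [zero_mul] at this
      exact this.eventually (gt_mem_nhds Real.pi_pos)
    filter_upwards [h1, self_mem_nhdsWithin] with t ht1 ht0
    have ht0 : 0 < t := ht0
    have hn : ‖t • θ‖ = t * ‖θ‖ := by rw [norm_smul, Real.norm_of_nonneg ht0.le]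
    have a1 := hchi (t • θ) (fun i => (norm_le_pi_norm (t • θ) i).trans (by rw [hn]; exact ht1.le))
    have a2 := chi_taylor q m S M hq0 hq1 hm hS hMs hM (t • θ)
    have a3 : (t • θ) ⬝ᵥ S *ᵥ (t • θ) / 2 = t ^ 2 * s := by
      rw [mulVec_smul, dotProduct_smul, smul_dotProduct, hs, smul_eq_mul, smul_eq_mul]; ring
    rw [a3, hn] at a2
    rw [hn] at a1
    have a4 := (norm_sub_norm_le _ _).trans ((norm_sub_rev _ _).trans_le a2)
    rw [norm_mul, Complex.norm_exp_ofReal_mul_I, mul_one, Complex.norm_real] at a4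
    have a5 := Real.le_norm_self (1 - t ^ 2 * s)
    have a6 := exp_neg_taylor (u := c * (t * ‖θ‖) ^ 2) (by positivity)
    have a7 := (abs_le.1 a6).2
    have a8 : t ^ 2 * (c * ‖θ‖ ^ 2) ≤ t ^ 2 * (s + t * (K * ‖θ‖ ^ 3) + t ^ 2 * (c * ‖θ‖ ^ 2) ^ 2) := by
      have : K * (t * ‖θ‖) ^ 3 = t ^ 2 * (t * (K * ‖θ‖ ^ 3)) := by ring
      nlinarith
    exact le_of_mul_le_mul_left a8 (by positivity)
  have hlim : Filter.Tendsto (fun t : ℝ => s + t * (K * ‖θ‖ ^ 3) + t ^ 2 * (c * ‖θ‖ ^ 2) ^ 2)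
      (nhdsWithin 0 (Set.Ioi 0)) (nhds (s + 0 * (K * ‖θ‖ ^ 3) + 0 ^ 2 * (c * ‖θ‖ ^ 2) ^ 2)) := by
    refine Filter.Tendsto.mono_left (Continuous.tendsto ?_ 0) nhdsWithin_le_nhds
    fun_prop
  have := ge_of_tendsto hlim hev
  simpa using this

lemma chi_cont {d : ℕ} (q : (Fin d → ℤ) → ℝ) (sq : Summable q) : Continuous (chi q) := by
  unfold chi
  refine continuous_tsum (fun x => continuous_const.mul (chr_cont x)) sq.norm fun x θ => ?_
  simp [chr_norm]

lemma mem_fbox_abs {d : ℕ} {θ : Fin d → ℝ} (h : θ ∈ fbox d) (i : Fin d) : |θ i| ≤ Real.pi := by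
  have := h i (Set.mem_univ i)
  exact abs_le.2 ⟨this.1.le, this.2⟩

lemma notMem_fbox {d : ℕ} {θ : Fin d → ℝ} (h : θ ∉ fbox d) : 1 ≤ ‖θ‖ := by
  by_contra hlt
  push Not at hlt
  apply h
  intro i _
  have h1 := (norm_le_pi_norm θ i).trans_lt hlt
  rw [Real.norm_eq_abs, abs_lt] at h1
  have := Real.pi_gt_three
  exact ⟨by linarith, by linarith⟩

open MeasureTheory in
lemma uniform_lclt {d : ℕ} (hd : 0 < d) (M c : ℝ) (hc : 0 < c) :
    ∃ C : ℝ, ∀ (q : (Fin d → ℤ) → ℝ) (m : Fin d → ℝ) (S : Matrix (Fin d) (Fin d) ℝ),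
    (∀ x, 0 ≤ q x) → HasSum q 1 → (∀ i, HasSum (fun x => q x * castV x i) (m i)) →
    (∀ i j, HasSum (fun x => q x * (castV x i * castV x j)) (S i j + m i * m j)) →
    (Summable fun x => q x * (1 + ‖castV x‖) ^ 3) →
    (∑' x, q x * (1 + ‖castV x‖) ^ 3 ≤ M) →
    (∀ θ : Fin d → ℝ, (∀ i, |θ i| ≤ Real.pi) → ‖chi q θ‖ ≤ Real.exp (-(c * ‖θ‖ ^ 2))) →
    ∀ n : ℕ, 1 ≤ n → ∀ x : Fin d → ℤ, castV x = (n : ℝ) • m →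
    |convPowD q n x - (2 * Real.pi * n) ^ (-(d : ℝ) / 2) * (Real.sqrt S.det)⁻¹|
      ≤ C / (n : ℝ) ^ (((d : ℝ) + 1) / 2) := by
  set K := 4 * (d * (1 + M)) ^ 3 * M with hK
  set B := (d * (1 + M)) ^ 2 * M with hB
  set K2 := (K + B ^ 2 * Real.pi) * Real.exp (c * Real.pi ^ 2) with hK2
  set J := ∫ θ : Fin d → ℝ, ‖θ‖ ^ 3 * Real.exp (-(c * ‖θ‖ ^ 2)) with hJ
  refine ⟨(K2 + 1) * J, ?_⟩
  intro q m S hq0 hq1 hm hS hMs hM hchi n hn x hx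
  have hn0 : (0 : ℝ) < n := by exact_mod_cast hn
  have hpi := Real.pi_pos
  obtain ⟨hM0, -⟩ := mean_bound q m M hq0 hm hMs hM
  have hlow := quad_lower q m S M c hq0 hq1 hm hS hMs hM hc hchi
  have hup := quad_upper q m S M hq0 hq1 hm hS hMs hM
  have htay := chi_taylor q m S M hq0 hq1 hm hS hMs hM
  have hJ0 : 0 ≤ J := integral_nonneg fun θ => by positivity
  have hfin := fbox_finite d
  -- positive definiteness
  have hSpd : S.PosDef := by
    refine Matrix.PosDef.of_dotProduct_mulVec_pos ?_ ?_
    · ext i j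
      simp only [conjTranspose_apply, star_trivial]
      have h1 := hS j i
      have h2 := hS i j
      simp_rw [mul_comm (castV _ j) (castV _ i)] at h1
      have := h1.unique h2
      linarith [mul_comm (m i) (m j)]
    · intro θ hθ
      have := hlow θ
      have h2 : 0 < ‖θ‖ := norm_pos_iff.2 hθ
      have h3 : 0 < c * ‖θ‖ ^ 2 := by positivity
      simp only [star_trivial]
      linarith
  let ψ : (Fin d → ℝ) → ℂ := fun θ => chi q θ * Complex.exp (((-(θ ⬝ᵥ m) : ℝ) : ℂ) * Complex.I)
  let g : (Fin d → ℝ) → ℝ := fun θ => Real.exp (-((θ ⬝ᵥ S *ᵥ θ) / 2))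
  have hψn : ∀ θ, ‖ψ θ‖ = ‖chi q θ‖ := by
    intro θ; simp only [ψ, norm_mul]; rw [Complex.norm_exp_ofReal_mul_I, mul_one]
  have hψc : Continuous ψ := by
    refine (chi_cont q hq1.summable).mul ?_
    unfold dotProduct; fun_prop
  have hgc : Continuous g := by unfold g dotProduct mulVec dotProduct; fun_prop
  have hgb : ∀ θ, g θ ≤ Real.exp (-(c * ‖θ‖ ^ 2)) := fun θ => Real.exp_le_exp.2 (by linarith [hlow θ])
  have hgn : ∀ θ, g θ ^ n = Real.exp (-(n * ((θ ⬝ᵥ S *ᵥ θ) / 2))) := by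
    intro θ; simp only [g]; rw [← Real.exp_nat_mul]; ring_nf
  -- Fourier inversion
  have hF : ∫ θ in fbox d, (ψ θ) ^ n = (convPowD q n x : ℂ) * ((2 * Real.pi : ℝ) : ℂ) ^ d := by
    obtain ⟨-, f2, f3⟩ := convPow_facts q hq0 hq1.summable n
    rw [← fourier_inv _ f2 x]
    congr 1
    ext θ
    rw [f3 θ]
    simp only [ψ, mul_pow]
    congr 1
    have : castV (-x) = - castV x := by ext i; simp [castV]
    rw [chr, ← Complex.exp_nat_mul, this, hx, dotProduct_neg, dotProduct_smul]
    congr 1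
    push_cast
    rw [smul_eq_mul]
    push_cast
    ring
  have hG := gauss_integral S hSpd n hn0
  simp_rw [← hgn] at hG
  set h : (Fin d → ℝ) → ℝ := fun θ => ‖θ‖ ^ 3 * Real.exp (-(c * n * ‖θ‖ ^ 2)) with hh
  have hhi : Integrable h := h_integrable hd (c * n) (by positivity) 3
  have hh0 : ∀ θ, 0 ≤ h θ := fun θ => by simp only [hh]; positivity
  have hexpn : ∀ θ : Fin d → ℝ, Real.exp (-(c * ‖θ‖ ^ 2)) ^ n = Real.exp (-(c * n * ‖θ‖ ^ 2)) := by
    intro θ; rw [← Real.exp_nat_mul]; ring_nf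
  have hgbn : ∀ θ, g θ ^ n ≤ Real.exp (-(c * n * ‖θ‖ ^ 2)) := fun θ => by
    rw [← hexpn]; exact pow_le_pow_left₀ (Real.exp_pos _).le (hgb θ) n
  have hgi : Integrable fun θ => g θ ^ n := by
    have i0 := h_integrable hd (c * n) (by positivity) 0
    refine i0.mono' (hgc.pow n).aestronglyMeasurable (Filter.Eventually.of_forall fun θ => ?_)
    rw [Real.norm_of_nonneg (pow_nonneg (Real.exp_pos _).le _)]
    simpa using hgbn θ
  -- pointwise bound
  have hpt : ∀ θ ∈ fbox d, ‖(ψ θ) ^ n - ((g θ ^ n : ℝ) : ℂ)‖ ≤ n * K2 * h θ := by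
    intro θ hθ
    have hθ1 : ‖θ‖ ≤ Real.pi := (pi_norm_le_iff_of_nonneg hpi.le).2 fun i => mem_fbox_abs hθ i
    have a1 : ‖ψ θ - (g θ : ℂ)‖ ≤ (K + B ^ 2 * Real.pi) * ‖θ‖ ^ 3 := by
      have b1 := htay θ
      have hs0 : 0 ≤ (θ ⬝ᵥ S *ᵥ θ) / 2 := le_trans (by positivity) (hlow θ)
      have b2 := exp_neg_taylor hs0
      have b3 : ((θ ⬝ᵥ S *ᵥ θ) / 2) ^ 2 ≤ B ^ 2 * Real.pi * ‖θ‖ ^ 3 := by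
        have : (θ ⬝ᵥ S *ᵥ θ) / 2 ≤ B * ‖θ‖ ^ 2 := by
          have := hup θ; linarith
        calc ((θ ⬝ᵥ S *ᵥ θ) / 2) ^ 2 ≤ (B * ‖θ‖ ^ 2) ^ 2 := by gcongr
          _ = B ^ 2 * ‖θ‖ * ‖θ‖ ^ 3 := by ring
          _ ≤ _ := by gcongr
      have e : ψ θ - (g θ : ℂ) = (ψ θ - ((1 - (θ ⬝ᵥ S *ᵥ θ) / 2 : ℝ) : ℂ))
          - ((g θ - (1 - (θ ⬝ᵥ S *ᵥ θ) / 2) : ℝ) : ℂ) := by push_cast; ring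
      rw [e]
      refine (norm_sub_le _ _).trans ?_
      rw [Complex.norm_real, Real.norm_eq_abs, add_mul]
      exact add_le_add b1 (b2.trans b3)
    obtain ⟨k, rfl⟩ : ∃ k, n = k + 1 := ⟨n - 1, by omega⟩
    have a2 := pow_sub_pow_bound (ψ θ) (g θ : ℂ) (Real.exp (-(c * ‖θ‖ ^ 2))) (Real.exp_pos _).le
      (by rw [hψn]; exact hchi θ (mem_fbox_abs hθ))
      (by rw [Complex.norm_real, Real.norm_of_nonneg (Real.exp_pos _).le]; exact hgb θ) k
    have a3 : Real.exp (-(c * ‖θ‖ ^ 2)) ^ k ≤ Real.exp (c * Real.pi ^ 2) * Real.exp (-(c * (k + 1 : ℕ) * ‖θ‖ ^ 2)) := by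
      rw [← hexpn, pow_succ _ k, mul_left_comm]
      refine le_mul_of_one_le_right (pow_nonneg (Real.exp_pos _).le k) ?_
      rw [← Real.exp_add]
      refine Real.one_le_exp ?_
      have : c * ‖θ‖ ^ 2 ≤ c * Real.pi ^ 2 := by gcongr
      linarith
    push_cast at a2 ⊢
    refine a2.trans ?_
    calc ((k : ℝ) + 1) * Real.exp (-(c * ‖θ‖ ^ 2)) ^ k * ‖ψ θ - (g θ : ℂ)‖
        ≤ ((k : ℝ) + 1) * (Real.exp (c * Real.pi ^ 2) * Real.exp (-(c * (k + 1 : ℕ) * ‖θ‖ ^ 2))) *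
          ((K + B ^ 2 * Real.pi) * ‖θ‖ ^ 3) := by gcongr
      _ = _ := by simp only [hh, hK2]; ring
  have hK20 : 0 ≤ K2 := by positivity
  -- assemble
  have hψi : Integrable (fun θ => (ψ θ) ^ n) (volume.restrict (fbox d)) := by
    refine Integrable.of_bound (C := 1) (hψc.pow n).aestronglyMeasurable ?_
    refine (ae_restrict_mem (fbox_meas d)).mono fun θ hθ => ?_
    rw [norm_pow]
    refine pow_le_one₀ (norm_nonneg _) ?_
    rw [hψn]
    refine (hchi θ (mem_fbox_abs hθ)).trans (Real.exp_le_one_iff.2 ?_)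
    have : 0 ≤ c * ‖θ‖ ^ 2 := by positivity
    linarith
  have hmain : ‖(∫ θ in fbox d, (ψ θ) ^ n) - ((∫ θ, g θ ^ n : ℝ) : ℂ)‖ ≤ (n * K2 + 1) * ∫ θ, h θ := by
    have s1 := integral_add_compl (fbox_meas d) hgi
    have s2 := integral_add_compl (fbox_meas d) hhi
    have s3 : (∫ θ in fbox d, (ψ θ) ^ n) - ((∫ θ, g θ ^ n : ℝ) : ℂ)
        = (∫ θ in fbox d, ((ψ θ) ^ n - ((g θ ^ n : ℝ) : ℂ))) - ((∫ θ in (fbox d)ᶜ, g θ ^ n : ℝ) : ℂ) := by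
      have hgi' : Integrable (fun θ => ((g θ ^ n : ℝ) : ℂ)) (volume.restrict (fbox d)) :=
        hgi.integrableOn.ofReal
      rw [integral_sub hψi hgi', ← s1, integral_complex_ofReal]
      push_cast; ring
    rw [s3]
    refine (norm_sub_le _ _).trans ?_
    have s4 : ‖∫ θ in fbox d, ((ψ θ) ^ n - ((g θ ^ n : ℝ) : ℂ))‖ ≤ ∫ θ in fbox d, n * K2 * h θ := by
      refine norm_integral_le_of_norm_le (hhi.integrableOn.const_mul _) ?_
      exact (ae_restrict_mem (fbox_meas d)).mono hpt
    have s5 : ‖((∫ θ in (fbox d)ᶜ, g θ ^ n : ℝ) : ℂ)‖ ≤ ∫ θ in (fbox d)ᶜ, h θ := by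
      rw [Complex.norm_real]
      refine norm_integral_le_of_norm_le hhi.integrableOn ?_
      refine (ae_restrict_mem (fbox_meas d).compl).mono fun θ hθ => ?_
      rw [Real.norm_of_nonneg (pow_nonneg (Real.exp_pos _).le _)]
      refine (hgbn θ).trans ?_
      exact le_mul_of_one_le_left (Real.exp_pos _).le (one_le_pow₀ (notMem_fbox hθ))
    rw [integral_const_mul] at s4
    have s6 : 0 ≤ ∫ θ in fbox d, h θ := integral_nonneg hh0
    have s7 : 0 ≤ ∫ θ in (fbox d)ᶜ, h θ := integral_nonneg hh0
    have s8 : 0 ≤ n * K2 := by positivity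
    rw [← s2]
    nlinarith [mul_nonneg s8 s7]
  rw [hF, hG, h_scaling c n hn] at hmain
  have hpow : (2 * Real.pi / n) ^ ((d : ℝ) / 2)
      = (2 * Real.pi * n) ^ (-(d : ℝ) / 2) * (2 * Real.pi) ^ d := by
    rw [neg_div, Real.rpow_neg (by positivity), Real.mul_rpow (by positivity) hn0.le,
      Real.div_rpow (by positivity) hn0.le]
    have : ((2 : ℝ) * Real.pi) ^ d = (2 * Real.pi) ^ ((d : ℝ) / 2) * (2 * Real.pi) ^ ((d : ℝ) / 2) := by
      rw [← Real.rpow_add (by positivity), ← Real.rpow_natCast]; congr 1; ring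
    rw [this]
    have h1 : 0 < (2 * Real.pi) ^ ((d : ℝ) / 2) := by positivity
    have h2 : 0 < (n : ℝ) ^ ((d : ℝ) / 2) := by positivity
    field_simp
  rw [hpow] at hmain
  have e9 : (convPowD q n x : ℂ) * ((2 * Real.pi : ℝ) : ℂ) ^ d
      - (((2 * Real.pi * n) ^ (-(d : ℝ) / 2) * (2 * Real.pi) ^ d * (Real.sqrt S.det)⁻¹ : ℝ) : ℂ)
      = (((convPowD q n x - (2 * Real.pi * n) ^ (-(d : ℝ) / 2) * (Real.sqrt S.det)⁻¹) * (2 * Real.pi) ^ d : ℝ) : ℂ) := by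
    push_cast; ring
  rw [e9, Complex.norm_real, Real.norm_eq_abs, abs_mul, abs_of_pos (a := (2 * Real.pi) ^ d) (by positivity)] at hmain
  have h2pi : (1 : ℝ) ≤ (2 * Real.pi) ^ d := one_le_pow₀ (by linarith [Real.pi_gt_three])
  refine (le_mul_of_one_le_right (abs_nonneg _) h2pi).trans (hmain.trans ?_)
  have e10 : (n : ℝ) ^ (-(((d : ℝ) + 3) / 2)) = (n : ℝ)⁻¹ / (n : ℝ) ^ (((d : ℝ) + 1) / 2) := by
    have : -(((d : ℝ) + 3) / 2) = -1 - ((d : ℝ) + 1) / 2 := by ring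
    rw [this, Real.rpow_sub hn0, Real.rpow_neg_one]
  rw [e10, ← hJ]
  have e11 : (n * K2 + 1) * ((n : ℝ)⁻¹ / (n : ℝ) ^ (((d : ℝ) + 1) / 2) * J)
      = (K2 + (n : ℝ)⁻¹) * J / (n : ℝ) ^ (((d : ℝ) + 1) / 2) := by
    field_simp
  rw [e11]
  have : (n : ℝ)⁻¹ ≤ 1 := inv_le_one_of_one_le₀ (by exact_mod_cast hn)
  gcongr

lemma norm_one_add_exp (t : ℝ) (ht : |t| ≤ Real.pi) :
    ‖1 + Complex.exp ((t : ℂ) * Complex.I)‖ ≤ 2 - t ^ 2 / Real.pi ^ 2 := by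
  have e : 1 + Complex.exp ((t : ℂ) * Complex.I)
      = Complex.exp (((t / 2 : ℝ) : ℂ) * Complex.I) * ((2 * Real.cos (t / 2) : ℝ) : ℂ) := by
    push_cast
    rw [Complex.cos]
    have h1 : Complex.exp ((t : ℂ) * Complex.I) = Complex.exp ((t : ℂ) / 2 * Complex.I) * Complex.exp ((t : ℂ) / 2 * Complex.I) := by
      rw [← Complex.exp_add]; ring_nf
    have h2 : (1 : ℂ) = Complex.exp ((t : ℂ) / 2 * Complex.I) * Complex.exp (-((t : ℂ) / 2) * Complex.I) := by
      rw [← Complex.exp_add]; ring_nf; simp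
    rw [h1]
    nth_rewrite 1 [h2]
    ring
  have hb := abs_le.1 ht
  have hpi := Real.pi_pos
  have hc0 : 0 ≤ Real.cos (t / 2) := Real.cos_nonneg_of_mem_Icc ⟨by linarith [hb.1], by linarith [hb.2]⟩
  rw [e, norm_mul, Complex.norm_exp_ofReal_mul_I, one_mul, Complex.norm_real,
    Real.norm_of_nonneg (by positivity)]
  have h := Real.cos_le_one_sub_mul_cos_sq (x := t / 2) (by rw [abs_div, abs_two]; linarith)
  have : 2 / Real.pi ^ 2 * (t / 2) ^ 2 = t ^ 2 / Real.pi ^ 2 / 2 := by field_simp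
  linarith

lemma chi_norm_le {d : ℕ} (r : (Fin d → ℤ) → ℝ) (hr : ∀ x, 0 ≤ r x) (sr : Summable r) (θ : Fin d → ℝ) :
    ‖chi r θ‖ ≤ ∑' x, r x := by
  unfold chi
  refine tsum_of_norm_bounded sr.hasSum fun x => ?_
  simp [chr_norm, abs_of_nonneg (hr x)]

lemma chi_decay_one {d : ℕ} (q : (Fin d → ℤ) → ℝ) (hq : ∀ x, 0 ≤ q x) (hq1 : HasSum q 1)
    (α : ℝ) (hα : 0 < α) (i : Fin d) (h0 : α ≤ q 0) (hi : α ≤ q (Pi.single i 1)) (θ : Fin d → ℝ)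
    (hθ : |θ i| ≤ Real.pi) : ‖chi q θ‖ ≤ 1 - α * (θ i ^ 2 / Real.pi ^ 2) := by
  set e : Fin d → ℤ := Pi.single i 1 with he
  have hne : e ≠ 0 := by
    intro h; have := congrFun h i; simp [he] at this
  let u : (Fin d → ℤ) → ℝ := fun x => (if x = 0 then α else 0) + (if x = e then α else 0)
  have hu : HasSum u (α + α) := (hasSum_ite_eq 0 α).add (hasSum_ite_eq e α)
  have hr := hq1.sub hu
  have hr0 : ∀ x, 0 ≤ q x - u x := by
    intro x
    simp only [u]
    by_cases hx0 : x = 0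
    · have : x ≠ e := by rw [hx0]; exact hne.symm
      rw [if_pos hx0, if_neg this, hx0]; linarith
    · by_cases hxe : x = e
      · rw [if_neg hx0, if_pos hxe, hxe]; linarith
      · rw [if_neg hx0, if_neg hxe]; linarith [hq x]
  have hchi : HasSum (fun x => (q x : ℂ) * chr θ x)
      (chi (fun x => q x - u x) θ + α * (1 + Complex.exp ((θ i : ℂ) * Complex.I))) := by
    have h1 : HasSum (fun x => ((q x - u x : ℝ) : ℂ) * chr θ x) (chi (fun x => q x - u x) θ) := by
      refine Summable.hasSum (Summable.of_norm ?_)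
      simp only [norm_mul, chr_norm, mul_one, Complex.norm_real]
      exact hr.summable.norm
    have h2 := (hasSum_ite_eq (0 : Fin d → ℤ) ((α : ℂ) * chr θ 0)).add (hasSum_ite_eq e ((α : ℂ) * chr θ e))
    have h3 : chr θ e = Complex.exp ((θ i : ℂ) * Complex.I) := by
      have : castV e = Pi.single i 1 := by
        ext j; simp only [castV, he, Pi.single_apply]; split_ifs <;> simp
      rw [chr, this]; simp
    convert! h1.add h2 using 1
    · ext x
      simp only [u]
      by_cases hx0 : x = 0
      · have : x ≠ e := by rw [hx0]; exact hne.symm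
        rw [if_pos hx0, if_neg this, if_pos hx0, if_neg this, hx0]; push_cast; ring
      · by_cases hxe : x = e
        · rw [if_neg hx0, if_pos hxe, if_neg hx0, if_pos hxe, hxe]; push_cast; ring
        · rw [if_neg hx0, if_neg hxe, if_neg hx0, if_neg hxe]; push_cast; ring
    · rw [h3, chr_zero]; ring
  have : chi q θ = _ := hchi.tsum_eq
  rw [this]
  refine (norm_add_le _ _).trans ?_
  have n1 := chi_norm_le (fun x => q x - u x) hr0 hr.summable θ
  rw [hr.tsum_eq] at n1
  have n2 := norm_one_add_exp (θ i) hθ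
  rw [norm_mul, Complex.norm_real, Real.norm_of_nonneg hα.le]
  nlinarith

lemma chi_decay {d : ℕ} (hd : 0 < d) (q : (Fin d → ℤ) → ℝ) (hq : ∀ x, 0 ≤ q x) (hq1 : HasSum q 1)
    (N : ℕ) (hN : 1 ≤ N) (α : ℝ) (hα : 0 < α) (h0 : α ≤ convPowD q N 0)
    (hi : ∀ i, α ≤ convPowD q N (Pi.single i 1)) (θ : Fin d → ℝ)
    (hθ : ∀ i, |θ i| ≤ Real.pi) :
    ‖chi q θ‖ ≤ Real.exp (-(α / (Real.pi ^ 2 * N) * ‖θ‖ ^ 2)) := by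
  obtain ⟨f1, f2, f3⟩ := convPow_facts q hq hq1.summable N
  have hN0 : (0 : ℝ) < N := by exact_mod_cast hN
  have hpi := Real.pi_pos
  have hs : HasSum (convPowD q N) 1 := by
    have h1 := f3 0
    have hz : ∀ x : Fin d → ℤ, chr 0 x = 1 := fun x => by simp [chr]
    simp only [chi, hz, mul_one] at h1
    rw [← Complex.ofReal_tsum, ← Complex.ofReal_tsum, hq1.tsum_eq] at h1
    have h2 : ∑' x, convPowD q N x = 1 := by
      have : ((∑' x, convPowD q N x : ℝ) : ℂ) = ((1 : ℝ) : ℂ) := by rw [h1]; simp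
      exact_mod_cast this
    rw [← h2]; exact f2.hasSum
  have : Nonempty (Fin d) := ⟨⟨0, hd⟩⟩
  obtain ⟨i, hi'⟩ : ∃ i, ‖θ‖ = |θ i| := by
    obtain ⟨i, -, hmax⟩ := Finset.exists_max_image Finset.univ (fun i => |θ i|) Finset.univ_nonempty
    exact ⟨i, le_antisymm ((pi_norm_le_iff_of_nonneg (abs_nonneg _)).2 fun j => hmax j (Finset.mem_univ j))
      (norm_le_pi_norm θ i)⟩
  have h1 := chi_decay_one _ f1 hs α hα i h0 (hi i) θ (hθ i)
  rw [f3, norm_pow] at h1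
  have h2 : ‖chi q θ‖ ^ N ≤ Real.exp (-(α / (Real.pi ^ 2 * N) * ‖θ‖ ^ 2)) ^ N := by
    rw [← Real.exp_nat_mul]
    have e : (N : ℝ) * -(α / (Real.pi ^ 2 * N) * ‖θ‖ ^ 2) = -(α * (θ i ^ 2 / Real.pi ^ 2)) := by
      rw [hi', sq_abs]; field_simp
    rw [e]
    refine h1.trans ?_
    have := Real.add_one_le_exp (-(α * (θ i ^ 2 / Real.pi ^ 2)))
    linarith
  exact le_of_pow_le_pow_left₀ (by omega) (Real.exp_pos _).le h2

/-- weighted exponential sums -/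
noncomputable def Gs {d : ℕ} (f : (Fin d → ℤ) → ℝ) (l : Fin d → ℝ) : ℝ :=
  ∑' x, f x * Real.exp (l ⬝ᵥ castV x)

/-- dot product functional -/
noncomputable def dotL {d : ℕ} (v : Fin d → ℝ) : (Fin d → ℝ) →L[ℝ] ℝ :=
  ∑ i, v i • ContinuousLinearMap.proj (R := ℝ) (φ := fun _ : Fin d => ℝ) i

lemma dotL_apply {d : ℕ} (v u : Fin d → ℝ) : dotL v u = u ⬝ᵥ v := by
  simp [dotL, dotProduct, mul_comm]

lemma dotL_norm {d : ℕ} (v : Fin d → ℝ) : ‖dotL v‖ ≤ d * ‖v‖ := by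
  refine ContinuousLinearMap.opNorm_le_bound _ (by positivity) fun u => ?_
  rw [dotL_apply, Real.norm_eq_abs]
  refine (dot_bound _ _).trans (le_of_eq (by ring))

lemma exp_dot_le {d : ℕ} {b r : ℝ} (hr : d * r ≤ b) {l : Fin d → ℝ} (hl : ‖l‖ ≤ r) (v : Fin d → ℝ) :
    |l ⬝ᵥ v| ≤ b * ‖v‖ := by
  refine (dot_bound l v).trans ?_
  have : d * ‖l‖ ≤ b := le_trans (by gcongr) hr
  gcongr

lemma Gs_summable {d : ℕ} (f : (Fin d → ℤ) → ℝ) {b r : ℝ} (hr : d * r ≤ b)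
    (hf : Summable fun x => |f x| * Real.exp (b * ‖castV x‖)) {l : Fin d → ℝ} (hl : ‖l‖ ≤ r) :
    Summable fun x => f x * Real.exp (l ⬝ᵥ castV x) := by
  refine Summable.of_norm_bounded hf fun x => ?_
  rw [norm_mul, Real.norm_eq_abs, Real.norm_of_nonneg (Real.exp_pos _).le]
  gcongr
  exact (le_abs_self _).trans (exp_dot_le hr hl _)

lemma Gs_analytic {d : ℕ} (f : (Fin d → ℤ) → ℝ) {b r : ℝ} (hr0 : 0 < r) (hr : d * r ≤ b)
    (hf : Summable fun x => |f x| * Real.exp (b * ‖castV x‖)) :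
    AnalyticOnNhd ℝ (Gs f) (Metric.ball 0 r) := by
  let t : (k : ℕ) → (Fin d → ℤ) → ContinuousMultilinearMap ℝ (fun _ : Fin k => (Fin d → ℝ)) ℝ :=
    fun k x => (f x / (k.factorial : ℝ)) •
      (ContinuousMultilinearMap.mkPiAlgebraFin ℝ k ℝ).compContinuousLinearMap (fun _ => dotL (castV x))
  have htn : ∀ k x, ‖t k x‖ ≤ (r ^ k)⁻¹ * (|f x| * Real.exp (b * ‖castV x‖)) := by
    intro k x
    have h1 : ‖(ContinuousMultilinearMap.mkPiAlgebraFin ℝ k ℝ).compContinuousLinearMap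
        (fun _ => dotL (castV x))‖ ≤ (d * ‖castV x‖) ^ k := by
      refine (ContinuousMultilinearMap.norm_compContinuousLinearMap_le _ _).trans ?_
      rw [ContinuousMultilinearMap.norm_mkPiAlgebraFin, one_mul, Finset.prod_const, Finset.card_univ,
        Fintype.card_fin]
      exact pow_le_pow_left₀ (norm_nonneg _) (dotL_norm _) k
    simp only [t]
    rw [norm_smul, norm_div, Real.norm_eq_abs, Real.norm_natCast]
    have h2 := Real.pow_div_factorial_le_exp (b * ‖castV x‖)
      (mul_nonneg (le_trans (by positivity) hr) (norm_nonneg _)) k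
    have h3 : (d * ‖castV x‖) ^ k / (k.factorial : ℝ) ≤ (r ^ k)⁻¹ * Real.exp (b * ‖castV x‖) := by
      rw [inv_mul_eq_div, le_div_iff₀ (by positivity)]
      refine le_trans ?_ h2
      rw [div_mul_eq_mul_div, ← mul_pow]
      have : d * ‖castV x‖ * r ≤ b * ‖castV x‖ := by
        calc d * ‖castV x‖ * r = d * r * ‖castV x‖ := by ring
          _ ≤ _ := by gcongr
      gcongr
    calc _ ≤ |f x| / (k.factorial : ℝ) * (d * ‖castV x‖) ^ k := by gcongr
      _ = |f x| * ((d * ‖castV x‖) ^ k / (k.factorial : ℝ)) := by ring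
      _ ≤ |f x| * ((r ^ k)⁻¹ * Real.exp (b * ‖castV x‖)) := by gcongr
      _ = _ := by ring
  have hts : ∀ k, Summable (t k) := fun k => Summable.of_norm_bounded (hf.mul_left _) (htn k)
  let P : FormalMultilinearSeries ℝ (Fin d → ℝ) ℝ := fun k => ∑' x, t k x
  have hPn : ∀ k, ‖P k‖ * r ^ k ≤ ∑' x, |f x| * Real.exp (b * ‖castV x‖) := by
    intro k
    have : ‖P k‖ ≤ ∑' x, (r ^ k)⁻¹ * (|f x| * Real.exp (b * ‖castV x‖)) :=
      tsum_of_norm_bounded (hf.mul_left _).hasSum (htn k)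
    rw [tsum_mul_left, inv_mul_eq_div, le_div_iff₀ (by positivity)] at this
    exact this
  have hps : HasFPowerSeriesOnBall (Gs f) P 0 (ENNReal.ofReal r) := by
    refine ⟨?_, by simpa using hr0, ?_⟩
    · refine P.le_radius_of_bound (∑' x, |f x| * Real.exp (b * ‖castV x‖)) (r := r.toNNReal) fun k => ?_
      rw [Real.coe_toNNReal _ hr0.le]; exact hPn k
    · intro y hy
      rw [Metric.eball_ofReal, mem_ball_zero_iff] at hy
      rw [zero_add]
      have hty : ∀ k x, t k x (fun _ => y) = f x * ((y ⬝ᵥ castV x) ^ k / (k.factorial : ℝ)) := by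
        intro k x
        simp only [t, _root_.smul_apply,
          ContinuousMultilinearMap.compContinuousLinearMap_apply,
          ContinuousMultilinearMap.mkPiAlgebraFin_apply, dotL_apply, smul_eq_mul]
        rw [List.ofFn_const, List.prod_replicate]; ring
      let F : (Fin d → ℤ) × ℕ → ℝ := fun z => f z.1 * ((y ⬝ᵥ castV z.1) ^ z.2 / (z.2.factorial : ℝ))
      have hexps : ∀ u : ℝ, HasSum (fun k : ℕ => u ^ k / (k.factorial : ℝ)) (Real.exp u) := by
        intro u
        rw [Real.exp_eq_exp_ℝ]
        exact NormedSpace.expSeries_div_hasSum_exp u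
      have hFs : Summable F := by
        refine Summable.of_norm ?_
        have hnorm : ∀ z, ‖F z‖ = |f z.1| * (|y ⬝ᵥ castV z.1| ^ z.2 / (z.2.factorial : ℝ)) := by
          intro z; simp [F, abs_mul, abs_div, abs_pow]
        rw [summable_prod_of_nonneg (fun z => norm_nonneg _)]
        simp only [hnorm]
        refine ⟨fun x => ((hexps _).mul_left _).summable, ?_⟩
        simp_rw [tsum_mul_left, (hexps _).tsum_eq]
        refine Summable.of_nonneg_of_le (fun x => by positivity) (fun x => ?_) hf
        gcongr
        exact exp_dot_le hr hy.le _
      have hG : HasSum F (Gs f y) := by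
        have h1 := hFs.hasSum.prod_fiberwise (fun x => (hexps (y ⬝ᵥ castV x)).mul_left (f x))
        have h2 : Gs f y = ∑' z, F z := h1.tsum_eq
        rw [h2]; exact hFs.hasSum
      have hG' := (Equiv.prodComm ℕ (Fin d → ℤ)).hasSum_iff.2 hG
      refine hG'.prod_fiberwise (fun k => ?_)
      have h1 := (hts k).hasSum.mapL (ContinuousMultilinearMap.apply ℝ (fun _ : Fin k => (Fin d → ℝ)) ℝ (fun _ => y))
      convert! h1 using 1
      ext x
      simp only [Function.comp, F, Equiv.prodComm_apply, Prod.swap, ContinuousMultilinearMap.apply_apply]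
      rw [hty]
  have := hps.analyticOnNhd
  rwa [Metric.eball_ofReal] at this

lemma Gs_hasFDerivAt {d : ℕ} (f : (Fin d → ℤ) → ℝ) {b r : ℝ} (hr0 : 0 < r) (hr : d * r ≤ b)
    (hf : Summable fun x => |f x| * (1 + ‖castV x‖) * Real.exp (b * ‖castV x‖))
    {l : Fin d → ℝ} (hl : ‖l‖ < r) :
    HasFDerivAt (Gs f) (dotL fun i => Gs (fun x => f x * castV x i) l) l := by
  have hf0 : Summable fun x => |f x| * Real.exp (b * ‖castV x‖) := by
    refine Summable.of_nonneg_of_le (fun x => by positivity) (fun x => ?_) hf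
    gcongr
    exact le_mul_of_one_le_right (abs_nonneg _) (by linarith [norm_nonneg (castV x)])
  have hfi : ∀ i, Summable fun x => |f x * castV x i| * Real.exp (b * ‖castV x‖) := by
    intro i
    refine Summable.of_nonneg_of_le (fun x => by positivity) (fun x => ?_) hf
    rw [abs_mul]
    gcongr
    have : |castV x i| ≤ ‖castV x‖ := norm_le_pi_norm (castV x) i
    linarith
  have key := hasFDerivAt_tsum_of_isPreconnected (𝕜 := ℝ)
    (f := fun (x : Fin d → ℤ) (l : Fin d → ℝ) => f x * Real.exp (l ⬝ᵥ castV x))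
    (f' := fun x l => f x • Real.exp (l ⬝ᵥ castV x) • dotL (castV x))
    (u := fun x => d * (|f x| * (1 + ‖castV x‖) * Real.exp (b * ‖castV x‖)))
    (s := Metric.ball 0 r) (x₀ := 0) (x := l) (hf.mul_left _) Metric.isOpen_ball
    (convex_ball _ _).isPreconnected ?_ ?_ (Metric.mem_ball_self hr0) ?_ (by simpa using hl)
  · convert! key using 1
    have h1 : HasSum (fun x => ∑ i, (f x * castV x i * Real.exp (l ⬝ᵥ castV x)) •
        (ContinuousLinearMap.proj i : (Fin d → ℝ) →L[ℝ] ℝ)) (dotL fun i => Gs (fun x => f x * castV x i) l) := by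
      unfold dotL
      refine hasSum_sum fun i _ => ?_
      exact (Gs_summable _ hr (hfi i) hl.le).hasSum.smul_const _
    rw [← h1.tsum_eq]
    refine tsum_congr fun x => ?_
    rw [dotL, Finset.smul_sum, Finset.smul_sum]
    refine Finset.sum_congr rfl fun i _ => ?_
    rw [smul_smul, smul_smul]
    congr 1; ring
  · intro x l _
    have h1 : HasFDerivAt (fun l : Fin d → ℝ => l ⬝ᵥ castV x) (dotL (castV x)) l := by
      have := (dotL (castV x)).hasFDerivAt (x := l)
      have e : (fun l : Fin d → ℝ => l ⬝ᵥ castV x) = dotL (castV x) := by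
        funext u; rw [dotL_apply]
      rw [e]; exact this
    exact h1.exp.const_mul (f x)
  · intro x l hl
    rw [mem_ball_zero_iff] at hl
    rw [norm_smul, norm_smul, Real.norm_eq_abs, Real.norm_of_nonneg (Real.exp_pos _).le]
    have h1 : Real.exp (l ⬝ᵥ castV x) ≤ Real.exp (b * ‖castV x‖) :=
      Real.exp_le_exp.2 ((le_abs_self _).trans (exp_dot_le hr hl.le _))
    have h2 : ‖dotL (castV x)‖ ≤ d * (1 + ‖castV x‖) := (dotL_norm _).trans (by gcongr; linarith)
    calc _ ≤ |f x| * (Real.exp (b * ‖castV x‖) * (d * (1 + ‖castV x‖))) := by gcongr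
      _ = _ := by ring
  · exact Gs_summable f hr hf0 (by simpa using hr0.le)

lemma local_inv {d : ℕ} (m : (Fin d → ℝ) → (Fin d → ℝ)) (hm : AnalyticAt ℝ m 0) (hm0 : m 0 = 0)
    (A : (Fin d → ℝ) ≃L[ℝ] (Fin d → ℝ)) (hA : HasFDerivAt m (A : (Fin d → ℝ) →L[ℝ] (Fin d → ℝ)) 0) :
    ∃ lam : (Fin d → ℝ) → (Fin d → ℝ), lam 0 = 0 ∧ (∀ᶠ ξ in nhds 0, m (lam ξ) = ξ) ∧
      (∀ᶠ ξ in nhds 0, AnalyticAt ℝ lam ξ) ∧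
      HasFDerivAt lam (A.symm : (Fin d → ℝ) →L[ℝ] (Fin d → ℝ)) 0 := by
  have hs : HasStrictFDerivAt m (A : (Fin d → ℝ) →L[ℝ] (Fin d → ℝ)) 0 := by
    have := hm.hasStrictFDerivAt
    rwa [hA.fderiv] at this
  have h1 := hs.eventually_right_inverse
  have h2 := hs.localInverse_apply_image
  have h3 := hs.to_localInverse
  have h4 : AnalyticAt ℝ (hs.localInverse m A 0) (m 0) := by
    obtain ⟨P, hP⟩ := hm
    refine (hs.toOpenPartialHomeomorph m).hasFPowerSeriesAt_symm (i := A)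
      hs.mem_toOpenPartialHomeomorph_source hP ?_ |>.analyticAt
    have h5 := hP.hasFDerivAt.unique hA
    rw [← h5]
    simp
  rw [hm0] at h1 h2 h3 h4
  exact ⟨hs.localInverse m A 0, h2, h1, h4.eventually_analyticAt, h3.hasFDerivAt⟩

lemma dotL_hasFDerivAt {d : ℕ} {lam : (Fin d → ℝ) → (Fin d → ℝ)} {ξ : Fin d → ℝ}
    {B : (Fin d → ℝ) →L[ℝ] (Fin d → ℝ)} (h : HasFDerivAt lam B ξ) :
    ∃ D : (Fin d → ℝ) →L[ℝ] ((Fin d → ℝ) →L[ℝ] ℝ), HasFDerivAt (fun ξ => dotL (lam ξ)) D ξ ∧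
      ∀ u, D u = dotL (B u) := by
  let Lm : (Fin d → ℝ) →ₗ[ℝ] ((Fin d → ℝ) →L[ℝ] ℝ) :=
    { toFun := dotL
      map_add' := fun u v => by ext w; simp [dotL_apply]
      map_smul' := fun c v => by ext w; simp [dotL_apply] }
  let Lc := LinearMap.toContinuousLinearMap Lm
  exact ⟨Lc.comp B, Lc.hasFDerivAt.comp ξ h, fun u => rfl⟩

lemma legendre_fderiv {d : ℕ} (Z : (Fin d → ℝ) → ℝ) (lam : (Fin d → ℝ) → (Fin d → ℝ)) (ξ : Fin d → ℝ)
    (hZ : HasFDerivAt Z (dotL (Z (lam ξ) • ξ)) (lam ξ)) (hZ0 : 0 < Z (lam ξ))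
    (hl : DifferentiableAt ℝ lam ξ) :
    HasFDerivAt (fun ξ => lam ξ ⬝ᵥ ξ - Real.log (Z (lam ξ))) (dotL (lam ξ)) ξ := by
  have h1 := hl.hasFDerivAt
  have hc : ∀ i, HasFDerivAt (fun ξ => lam ξ i)
      ((ContinuousLinearMap.proj i : (Fin d → ℝ) →L[ℝ] ℝ).comp (fderiv ℝ lam ξ)) ξ :=
    fun i => (ContinuousLinearMap.proj (R := ℝ) (φ := fun _ : Fin d => ℝ) i).hasFDerivAt.comp ξ h1
  have hc2 : ∀ i, HasFDerivAt (fun ξ : Fin d → ℝ => ξ i)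
      (ContinuousLinearMap.proj i : (Fin d → ℝ) →L[ℝ] ℝ) ξ :=
    fun i => (ContinuousLinearMap.proj (R := ℝ) (φ := fun _ : Fin d => ℝ) i).hasFDerivAt
  have h2 : HasFDerivAt (fun ξ => lam ξ ⬝ᵥ ξ) _ ξ :=
    HasFDerivAt.fun_sum (u := Finset.univ) (fun i _ => (hc i).mul (hc2 i))
  have h3 := (hZ.comp ξ h1).log (by simpa using hZ0.ne')
  refine (h2.sub h3).congr_fderiv ?_
  ext v
  simp [dotL_apply, dotProduct, Finset.sum_add_distrib, Finset.mul_sum]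
  have e1 : ∀ i, (Z (lam ξ))⁻¹ * ((fderiv ℝ lam ξ) v i * (Z (lam ξ) * ξ i)) = ξ i * (fderiv ℝ lam ξ) v i := by
    intro i
    field_simp
  simp only [e1, mul_comm (v _)]
  ring

lemma legendre_all {d : ℕ} (Z : (Fin d → ℝ) → ℝ) (m : (Fin d → ℝ) → (Fin d → ℝ)) {r : ℝ} (hr : 0 < r)
    (hZa : AnalyticOnNhd ℝ Z (Metric.ball 0 r)) (hZp : ∀ l, ‖l‖ < r → 0 < Z l)
    (hma : AnalyticOnNhd ℝ m (Metric.ball 0 r))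
    (hZd : ∀ l, ‖l‖ < r → HasFDerivAt Z (dotL (Z l • m l)) l)
    (hZ0 : Z 0 = 1) (hm0 : m 0 = 0) (Q : Matrix (Fin d) (Fin d) ℝ) (hQs : Qᵀ = Q) (hQd : IsUnit Q.det)
    (hmd : HasFDerivAt m (LinearMap.toContinuousLinearMap (Matrix.toLin' Q)) 0) :
    ∃ η > (0 : ℝ), ∃ lam : (Fin d → ℝ) → (Fin d → ℝ), lam 0 = 0 ∧
      (∀ ξ, ‖ξ‖ < η → AnalyticAt ℝ lam ξ ∧ ‖lam ξ‖ < r ∧ m (lam ξ) = ξ) ∧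
      ∃ I : (Fin d → ℝ) → ℝ, (∀ ξ, I ξ = lam ξ ⬝ᵥ ξ - Real.log (Z (lam ξ))) ∧
        AnalyticOnNhd ℝ I (Metric.ball 0 η) ∧ I 0 = 0 ∧ fderiv ℝ I 0 = 0 ∧
      (∀ u v : Fin d → ℝ, iteratedFDeriv ℝ 2 I 0 ![u, v] = u ⬝ᵥ (Q⁻¹).mulVec v) := by
  let A : (Fin d → ℝ) ≃L[ℝ] (Fin d → ℝ) := LinearEquiv.toContinuousLinearEquiv
    (Matrix.toLin'OfInv (Matrix.nonsing_inv_mul Q hQd) (Matrix.mul_nonsing_inv Q hQd))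
  have hA : HasFDerivAt m (A : (Fin d → ℝ) →L[ℝ] (Fin d → ℝ)) 0 := by
    refine hmd.congr_fderiv ?_
    ext u
    rfl
  have hAs : ∀ u, A.symm u = Q⁻¹ *ᵥ u := fun u => rfl
  obtain ⟨lam, hl0, hl1, hl2, hl3⟩ := local_inv m (hma 0 (Metric.mem_ball_self hr)) hm0 A hA
  have hl4 : ∀ᶠ ξ in nhds 0, ‖lam ξ‖ < r := by
    have := hl3.continuousAt.norm
    refine this.eventually (gt_mem_nhds ?_)
    change ‖lam 0‖ < r
    rw [hl0, norm_zero]; exact hr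
  obtain ⟨η, hη, H⟩ := Metric.eventually_nhds_iff.1 (hl1.and (hl2.and hl4))
  have H' : ∀ ξ, ‖ξ‖ < η → AnalyticAt ℝ lam ξ ∧ ‖lam ξ‖ < r ∧ m (lam ξ) = ξ := by
    intro ξ hξ
    have := H (y := ξ) (by simpa using hξ)
    exact ⟨this.2.1, this.2.2, this.1⟩
  let I : (Fin d → ℝ) → ℝ := fun ξ => lam ξ ⬝ᵥ ξ - Real.log (Z (lam ξ))
  have hId : ∀ ξ, ‖ξ‖ < η → HasFDerivAt I (dotL (lam ξ)) ξ := by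
    intro ξ hξ
    obtain ⟨h1, h2, h3⟩ := H' ξ hξ
    have := hZd _ h2
    rw [h3] at this
    exact legendre_fderiv Z lam ξ this (hZp _ h2) h1.differentiableAt
  refine ⟨η, hη, lam, hl0, H', I, fun _ => rfl, ?_, ?_, ?_, ?_⟩
  · intro ξ hξ
    rw [mem_ball_zero_iff] at hξ
    obtain ⟨h1, h2, h3⟩ := H' ξ hξ
    refine AnalyticAt.sub ?_ ?_
    · refine Finset.analyticAt_fun_sum _ fun i _ => ?_
      exact ((ContinuousLinearMap.proj (R := ℝ) (φ := fun _ : Fin d => ℝ) i).analyticAt _ |>.comp h1).mul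
        ((ContinuousLinearMap.proj (R := ℝ) (φ := fun _ : Fin d => ℝ) i).analyticAt _)
    · exact ((analyticAt_log (hZp _ h2)).comp (g := Real.log) (hZa (lam ξ) (by simpa using h2))).comp h1
  · simp [I, hl0, hZ0]
  · rw [(hId 0 (by simpa using hη)).fderiv, hl0]
    ext u; simp [dotL_apply]
  · intro u v
    obtain ⟨D, hD, hDu⟩ := dotL_hasFDerivAt hl3
    have he : fderiv ℝ I =ᶠ[nhds 0] fun ξ => dotL (lam ξ) := by
      filter_upwards [Metric.ball_mem_nhds 0 hη] with ξ hξ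
      exact (hId ξ (by simpa using hξ)).fderiv
    rw [iteratedFDeriv_two_apply, he.fderiv_eq, hD.fderiv, hDu, dotL_apply]
    simp only [Matrix.cons_val_zero, Matrix.cons_val_one]
    change v ⬝ᵥ (Q⁻¹ *ᵥ u) = _
    rw [Matrix.dotProduct_mulVec, ← Matrix.mulVec_transpose, Matrix.transpose_nonsing_inv, hQs, dotProduct_comm]

lemma weight_summable {d : ℕ} (p : (Fin d → ℤ) → ℝ) (hp : ∀ x, 0 ≤ p x) {b : ℝ} (hb : 0 < b)
    (h : Summable fun x : Fin d → ℤ => p x * Real.exp (2 * b * ‖castV x‖)) :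
    Summable fun x => p x * (1 + ‖castV x‖) ^ 3 * Real.exp (b * ‖castV x‖) := by
  set L := max 1 (3 / b) with hL
  have hL1 : 1 ≤ L := le_max_left _ _
  have hL2 : 3 / b ≤ L := le_max_right _ _
  have hb3 : 3 ≤ L * b := by rwa [div_le_iff₀ hb] at hL2
  refine Summable.of_nonneg_of_le
    (fun x => mul_nonneg (mul_nonneg (hp x) (by positivity)) (Real.exp_pos _).le) (fun x => ?_) (h.mul_left (L ^ 3))
  set t := ‖castV x‖ with ht
  have ht0 : 0 ≤ t := norm_nonneg _
  have h1 : 1 + t ≤ L * Real.exp (b * t / 3) := by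
    have h2 := Real.add_one_le_exp (b * t / 3)
    have h3 : L * (b * t / 3 + 1) ≤ L * Real.exp (b * t / 3) := by gcongr
    nlinarith
  have h4 : (1 + t) ^ 3 ≤ (L * Real.exp (b * t / 3)) ^ 3 := by gcongr
  have h5 : (L * Real.exp (b * t / 3)) ^ 3 = L ^ 3 * Real.exp (b * t) := by
    rw [mul_pow, ← Real.exp_nat_mul]; congr 2; push_cast; ring
  have h6 : Real.exp (2 * b * t) = Real.exp (b * t) * Real.exp (b * t) := by
    rw [← Real.exp_add]; congr 1; ring
  rw [h5] at h4
  have hpx := hp x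
  calc p x * (1 + t) ^ 3 * Real.exp (b * t) ≤ p x * (L ^ 3 * Real.exp (b * t)) * Real.exp (b * t) := by gcongr
    _ = _ := by rw [h6]; ring

lemma weight_cons {d : ℕ} (p : (Fin d → ℤ) → ℝ) (hp : ∀ x, 0 ≤ p x) {b : ℝ} (hb : 0 < b)
    (hW : Summable fun x => p x * (1 + ‖castV x‖) ^ 3 * Real.exp (b * ‖castV x‖)) :
    (Summable fun x => |p x| * Real.exp (b * ‖castV x‖)) ∧
    (Summable fun x => |p x| * (1 + ‖castV x‖) * Real.exp (b * ‖castV x‖)) ∧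
    (∀ i, Summable fun x => |p x * castV x i| * Real.exp (b * ‖castV x‖)) ∧
    (∀ i, Summable fun x => |p x * castV x i| * (1 + ‖castV x‖) * Real.exp (b * ‖castV x‖)) ∧
    (∀ i j, Summable fun x => |p x * castV x i * castV x j| * Real.exp (b * ‖castV x‖)) := by
  have key : ∀ f : (Fin d → ℤ) → ℝ, (∀ x, 0 ≤ f x) → (∀ x, f x ≤ p x * (1 + ‖castV x‖) ^ 3) →
      Summable fun x => f x * Real.exp (b * ‖castV x‖) := by
    intro f hf0 hf
    refine Summable.of_nonneg_of_le (fun x => mul_nonneg (hf0 x) (Real.exp_pos _).le) (fun x => ?_) hW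
    exact mul_le_mul_of_nonneg_right (hf x) (Real.exp_pos _).le
  have hc : ∀ (x : Fin d → ℤ) i, |castV x i| ≤ ‖castV x‖ := fun x i => norm_le_pi_norm (castV x) i
  have hc' : ∀ (x : Fin d → ℤ) i, |castV x i| ≤ 1 + ‖castV x‖ := fun x i => (hc x i).trans (by linarith)
  have h1 : ∀ x : Fin d → ℤ, 1 ≤ 1 + ‖castV x‖ := fun x => by linarith [norm_nonneg (castV x)]
  have hp3 : ∀ x k, k ≤ 3 → p x * (1 + ‖castV x‖) ^ k ≤ p x * (1 + ‖castV x‖) ^ 3 := fun x k hk =>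
    mul_le_mul_of_nonneg_left (pow_le_pow_right₀ (h1 x) hk) (hp x)
  refine ⟨key _ (fun x => abs_nonneg _) fun x => ?_, key _ (fun x => by positivity) fun x => ?_,
    fun i => key _ (fun x => abs_nonneg _) fun x => ?_, fun i => key _ (fun x => by positivity) fun x => ?_,
    fun i j => key _ (fun x => abs_nonneg _) fun x => ?_⟩
  · rw [abs_of_nonneg (hp x)]; simpa using hp3 x 0 (by norm_num)
  · rw [abs_of_nonneg (hp x)]; simpa using hp3 x 1 (by norm_num)
  · rw [abs_mul, abs_of_nonneg (hp x)]
    refine le_trans ?_ (hp3 x 1 (by norm_num))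
    rw [pow_one]
    exact mul_le_mul_of_nonneg_left (hc' x i) (hp x)
  · rw [abs_mul, abs_of_nonneg (hp x), mul_assoc]
    refine le_trans ?_ (hp3 x 2 (by norm_num))
    rw [sq]
    exact mul_le_mul_of_nonneg_left (mul_le_mul_of_nonneg_right (hc' x i) (by positivity)) (hp x)
  · rw [abs_mul, abs_mul, abs_of_nonneg (hp x), mul_assoc]
    refine le_trans ?_ (hp3 x 2 (by norm_num))
    rw [sq]
    exact mul_le_mul_of_nonneg_left (mul_le_mul (hc' x i) (hc' x j) (abs_nonneg _) (by positivity)) (hp x)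

/-- tilted mean -/
noncomputable def tm {d : ℕ} (p : (Fin d → ℤ) → ℝ) (l : Fin d → ℝ) : Fin d → ℝ :=
  fun i => Gs (fun x => p x * castV x i) l / Gs p l

/-- tilted covariance -/
noncomputable def tQ {d : ℕ} (p : (Fin d → ℤ) → ℝ) (l : Fin d → ℝ) : Matrix (Fin d) (Fin d) ℝ :=
  fun i j => Gs (fun x => p x * castV x i * castV x j) l / Gs p l - tm p l i * tm p l j

/-- tilted law -/
noncomputable def tq {d : ℕ} (p : (Fin d → ℤ) → ℝ) (l : Fin d → ℝ) : (Fin d → ℤ) → ℝ :=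
  fun x => p x * Real.exp (l ⬝ᵥ castV x) / Gs p l

lemma tilt_facts {d : ℕ} (p : (Fin d → ℤ) → ℝ) (hp : ∀ x, 0 ≤ p x) {b r : ℝ} (hb : 0 < b) (hr : d * r ≤ b)
    (hW : Summable fun x => p x * (1 + ‖castV x‖) ^ 3 * Real.exp (b * ‖castV x‖))
    {l : Fin d → ℝ} (hl : ‖l‖ ≤ r) (hZ : 1 / 2 ≤ Gs p l) :
    (∀ x, 0 ≤ tq p l x) ∧ HasSum (tq p l) 1 ∧
    (∀ i, HasSum (fun x => tq p l x * castV x i) (tm p l i)) ∧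
    (∀ i j, HasSum (fun x => tq p l x * (castV x i * castV x j)) (tQ p l i j + tm p l i * tm p l j)) ∧
    Summable (fun x => tq p l x * (1 + ‖castV x‖) ^ 3) ∧
    (∑' x, tq p l x * (1 + ‖castV x‖) ^ 3 ≤
      2 * ∑' x, p x * (1 + ‖castV x‖) ^ 3 * Real.exp (b * ‖castV x‖)) := by
  obtain ⟨s0, s1, s2, s3, s4⟩ := weight_cons p hp hb hW
  have hZ0 : 0 < Gs p l := by linarith
  have hle : ∀ x, tq p l x * (1 + ‖castV x‖) ^ 3 ≤
      2 * (p x * (1 + ‖castV x‖) ^ 3 * Real.exp (b * ‖castV x‖)) := by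
    intro x
    have h1 : Real.exp (l ⬝ᵥ castV x) ≤ Real.exp (b * ‖castV x‖) :=
      Real.exp_le_exp.2 ((le_abs_self _).trans (exp_dot_le hr hl _))
    have h2 : (Gs p l)⁻¹ ≤ 2 := by
      rw [inv_le_comm₀ hZ0 (by norm_num)]; linarith
    have hpx := hp x
    unfold tq
    rw [div_eq_mul_inv]
    calc _ ≤ p x * Real.exp (b * ‖castV x‖) * 2 * (1 + ‖castV x‖) ^ 3 := by gcongr
      _ = _ := by ring
  have hq0 : ∀ x, 0 ≤ tq p l x := fun x => div_nonneg (mul_nonneg (hp x) (Real.exp_pos _).le) hZ0.le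
  have hs3 : Summable (fun x => tq p l x * (1 + ‖castV x‖) ^ 3) :=
    Summable.of_nonneg_of_le (fun x => mul_nonneg (hq0 x) (by positivity)) hle (hW.mul_left 2)
  refine ⟨hq0, ?_, ?_, ?_, hs3, ?_⟩
  · have := (Gs_summable p hr s0 hl).hasSum.div_const (Gs p l)
    rwa [show (∑' x, p x * Real.exp (l ⬝ᵥ castV x)) / Gs p l = 1 from div_self hZ0.ne'] at this
  · intro i
    have := (Gs_summable _ hr (s2 i) hl).hasSum.div_const (Gs p l)
    convert! this using 1
    funext x; unfold tq; ring
  · intro i j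
    have := (Gs_summable _ hr (s4 i j) hl).hasSum.div_const (Gs p l)
    convert! this using 1
    · funext x; unfold tq; ring
    · unfold tQ Gs; ring
  · rw [← tsum_mul_left]
    exact hs3.tsum_le_tsum hle (hW.mul_left 2)

lemma tilt_decay {d : ℕ} (hd : 0 < d) (p : (Fin d → ℤ) → ℝ) (hp : ∀ x, 0 ≤ p x) {b r : ℝ} (hb : 0 < b)
    (hr : d * r ≤ b)
    (hW : Summable fun x => p x * (1 + ‖castV x‖) ^ 3 * Real.exp (b * ‖castV x‖))
    (hirr : ∀ x : Fin d → ℤ, ∃ N : ℕ, ∀ n ≥ N, 0 < convPowD p n x) :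
    ∃ c > (0 : ℝ), ∀ l : Fin d → ℝ, ‖l‖ ≤ r → 1 / 2 ≤ Gs p l → Gs p l ≤ 2 →
      ∀ θ : Fin d → ℝ, (∀ i, |θ i| ≤ Real.pi) → ‖chi (tq p l) θ‖ ≤ Real.exp (-(c * ‖θ‖ ^ 2)) := by
  choose F hF using hirr
  let T : Finset (Fin d → ℤ) := insert 0 (Finset.univ.image fun i => Pi.single i 1)
  have hTn : T.Nonempty := ⟨0, Finset.mem_insert_self _ _⟩
  let N := max 1 (T.sup F)
  have hN : 1 ≤ N := le_max_left _ _
  have hNT : ∀ y ∈ T, 0 < convPowD p N y := fun y hy =>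
    hF y N ((Finset.le_sup hy).trans (le_max_right _ _))
  let g : (Fin d → ℤ) → ℝ := fun y => convPowD p N y * Real.exp (-(b * ‖castV y‖)) / 2 ^ N
  obtain ⟨y0, hy0, hmin⟩ := T.exists_min_image g hTn
  have hα : 0 < g y0 := by
    have := hNT y0 hy0
    positivity
  have hN0 : (0 : ℝ) < N := by exact_mod_cast hN
  refine ⟨g y0 / (Real.pi ^ 2 * N), by have := Real.pi_pos; positivity, fun l hl hZ hZ2 θ hθ => ?_⟩
  obtain ⟨t1, t2, -⟩ := tilt_facts p hp hb hr hW hl hZ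
  have hZ0 : 0 < Gs p l := by linarith
  have hT : ∀ y ∈ T, g y0 ≤ convPowD (tq p l) N y := by
    intro y hy
    refine (hmin y hy).trans ?_
    have hpos := hNT y hy
    unfold tq
    rw [convPow_tilt]
    simp only [g]
    have h1 : -(b * ‖castV y‖) ≤ l ⬝ᵥ castV y := (abs_le.1 (exp_dot_le hr hl (castV y))).1
    gcongr
  exact chi_decay hd _ t1 t2 N hN _ hα (hT 0 (Finset.mem_insert_self _ _))
    (fun i => hT _ (Finset.mem_insert_of_mem (Finset.mem_image_of_mem _ (Finset.mem_univ _)))) θ hθ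

lemma Gs_zero {d : ℕ} (f : (Fin d → ℤ) → ℝ) : Gs f 0 = ∑' x, f x := by
  simp [Gs]

theorem saddle_point_local_limit
    {d : ℕ} (hd : 0 < d) (p : (Fin d → ℤ) → ℝ)
    (hp_nonneg : ∀ x, 0 ≤ p x) (hp_symm : ∀ x, p (-x) = p x)
    (hp_sum : ∑' x, p x = 1)
    (a : ℝ) (ha : 0 < a)
    (hexp : Summable fun x : Fin d → ℤ => p x * Real.exp (a * ‖castV x‖))
    (hirr_aper : ∀ x : Fin d → ℤ, ∃ N : ℕ, ∀ n ≥ N, 0 < convPowD p n x)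
    (Q : Matrix (Fin d) (Fin d) ℝ)
    (hQ : ∀ i j, Q i j = ∑' x : Fin d → ℤ, castV x i * castV x j * p x) :
    ∃ η > (0 : ℝ), ∃ (Qf : (Fin d → ℝ) → Matrix (Fin d) (Fin d) ℝ)
        (I : (Fin d → ℝ) → ℝ) (C : ℝ),
      (∀ i j, AnalyticOnNhd ℝ (fun ξ => Qf ξ i j) (Metric.ball 0 η)) ∧
      Qf 0 = Q ∧
      AnalyticOnNhd ℝ I (Metric.ball 0 η) ∧
      I 0 = 0 ∧ fderiv ℝ I 0 = 0 ∧
      (∀ u v : Fin d → ℝ, iteratedFDeriv ℝ 2 I 0 ![u, v] = u ⬝ᵥ (Q⁻¹).mulVec v) ∧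
      (∀ n : ℕ, 1 ≤ n → ∀ x : Fin d → ℤ, ‖(n : ℝ)⁻¹ • castV x‖ < η →
        |convPowD p n x * Real.exp ((n : ℝ) * I ((n : ℝ)⁻¹ • castV x))
            - (2 * Real.pi * n) ^ (-(d : ℝ) / 2)
              * (Real.sqrt (Qf ((n : ℝ)⁻¹ • castV x)).det)⁻¹|
          ≤ C / (n : ℝ) ^ (((d : ℝ) + 1) / 2)) := by
  have hd0 : (0 : ℝ) < d := by exact_mod_cast hd
  obtain ⟨b, hb, hab⟩ : ∃ b : ℝ, 0 < b ∧ a = 2 * b := ⟨a / 2, by positivity, by ring⟩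
  subst hab
  have hW := weight_summable p hp_nonneg hb hexp
  obtain ⟨s0, s1, s2, s3, s4⟩ := weight_cons p hp_nonneg hb hW
  set r := b / d with hrdef
  have hr0 : 0 < r := by positivity
  have hr : d * r ≤ b := by rw [hrdef]; field_simp; exact le_rfl
  have hZa := Gs_analytic p hr0 hr s0
  have hZ0 : Gs p 0 = 1 := by rw [Gs_zero, hp_sum]
  -- smaller ball
  obtain ⟨r1, hr1, hr1r, hZb⟩ : ∃ r1 > (0 : ℝ), r1 ≤ r ∧ ∀ l, ‖l‖ < r1 → 1 / 2 ≤ Gs p l ∧ Gs p l ≤ 2 := by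
    have hc := (hZa 0 (Metric.mem_ball_self hr0)).continuousAt
    have h1 : ∀ᶠ l in nhds 0, Gs p l ∈ Set.Icc (1 / 2 : ℝ) 2 := by
      refine hc.eventually (Icc_mem_nhds ?_ ?_) <;> rw [hZ0] <;> norm_num
    obtain ⟨ε, hε, H⟩ := Metric.eventually_nhds_iff.1 h1
    refine ⟨min ε r, lt_min hε hr0, min_le_right _ _, fun l hl => ?_⟩
    exact H (y := l) (by simpa using hl.trans_le (min_le_left _ _))
  have hZp : ∀ l, ‖l‖ < r1 → 0 < Gs p l := fun l hl => by linarith [(hZb l hl).1]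
  have hsub : Metric.ball (0 : Fin d → ℝ) r1 ⊆ Metric.ball 0 r := Metric.ball_subset_ball hr1r
  have hm1a : ∀ i, AnalyticOnNhd ℝ (fun l => tm p l i) (Metric.ball 0 r1) := fun i l hl =>
    (Gs_analytic _ hr0 hr (s2 i) l (hsub hl)).div (hZa l (hsub hl)) (hZp l (by simpa using hl)).ne'
  have hma : AnalyticOnNhd ℝ (tm p) (Metric.ball 0 r1) := fun l hl =>
    AnalyticAt.pi fun i => hm1a i l hl
  have hQa : ∀ i j, AnalyticOnNhd ℝ (fun l => tQ p l i j) (Metric.ball 0 r1) := fun i j l hl =>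
    ((Gs_analytic _ hr0 hr (s4 i j) l (hsub hl)).div (hZa l (hsub hl)) (hZp l (by simpa using hl)).ne').sub
      ((hm1a i l hl).mul (hm1a j l hl))
  have hG1 : ∀ i, Gs (fun x => p x * castV x i) 0 = 0 := by
    intro i
    rw [Gs_zero]
    have h1 := (Equiv.neg (Fin d → ℤ)).tsum_eq (fun x => p x * castV x i)
    have h2 : ∀ x : Fin d → ℤ, p (-x) * castV (-x) i = -(p x * castV x i) := by
      intro x; rw [hp_symm]; simp [castV]
    simp only [Equiv.neg_apply, h2, tsum_neg] at h1
    linarith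
  have hm0 : tm p 0 = 0 := by
    ext i; simp [tm, hG1]
  have hG2 : ∀ i j, Gs (fun x => p x * castV x i * castV x j) 0 = Q i j := by
    intro i j
    rw [Gs_zero, hQ]
    exact tsum_congr fun x => by ring
  have hQ0 : tQ p 0 = Q := by
    ext i j
    simp [tQ, hm0, hG2, hZ0]
  have hQs : Qᵀ = Q := by
    ext i j
    rw [Matrix.transpose_apply, hQ, hQ]
    exact tsum_congr fun x => by ring
  have hZd : ∀ l, ‖l‖ < r1 → HasFDerivAt (Gs p) (dotL (Gs p l • tm p l)) l := by
    intro l hl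
    have h := Gs_hasFDerivAt p hr0 hr s1 (hl.trans_le hr1r)
    have e : (fun i => Gs (fun x => p x * castV x i) l) = Gs p l • tm p l := by
      funext i
      simp only [Pi.smul_apply, smul_eq_mul, tm]
      rw [mul_div_cancel₀ _ (hZp l hl).ne']
    rwa [e] at h
  have hmd : HasFDerivAt (tm p) (LinearMap.toContinuousLinearMap (Matrix.toLin' Q)) 0 := by
    rw [hasFDerivAt_pi']
    intro i
    have h1 := Gs_hasFDerivAt _ hr0 hr (s3 i) (l := 0) (by simpa using hr0)
    have h2 := hZd 0 (by simpa using hr1)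
    have h3 := h1.mul ((hasDerivAt_inv (by rw [hZ0]; norm_num : Gs p 0 ≠ 0)).comp_hasFDerivAt (0 : Fin d → ℝ) h2)
    refine (h3.congr_fderiv ?_ : HasFDerivAt (fun l => Gs (fun x => p x * castV x i) l * (Gs p l)⁻¹) _ _)
    ext v
    simp only [hG1, hG2, hZ0, hm0]
    simp [dotL_apply, Matrix.mulVec, dotProduct_comm, hZ0]
  obtain ⟨c, hc, hdec⟩ := tilt_decay hd p hp_nonneg hb hr hW hirr_aper
  have hQd : IsUnit Q.det := by
    have hz : ‖(0 : Fin d → ℝ)‖ < r1 := by simpa using hr1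
    obtain ⟨t1, t2, t3, t4, t5, t6⟩ := tilt_facts p hp_nonneg hb hr hW (hz.le.trans hr1r) (hZb 0 hz).1
    have hql := quad_lower _ _ _ _ c t1 t2 t3 t4 t5 t6 hc (hdec 0 (hz.le.trans hr1r) (hZb 0 hz).1 (hZb 0 hz).2)
    rw [hQ0] at hql
    rw [isUnit_iff_ne_zero]
    intro h0
    obtain ⟨v, hv, hv0⟩ := Matrix.exists_mulVec_eq_zero_iff.2 h0
    have := hql v
    rw [hv0, dotProduct_zero] at this
    have : 0 < c * ‖v‖ ^ 2 := by have := norm_pos_iff.2 hv; positivity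
    linarith
  obtain ⟨η, hη, lam, hl0, hlam, I, hI, hIa, hI0, hI1, hI2⟩ := legendre_all (Gs p) (tm p) hr1
    (hZa.mono hsub) hZp hma hZd hZ0 hm0 Q hQs hQd hmd
  obtain ⟨C, hC⟩ := uniform_lclt hd (2 * ∑' x, p x * (1 + ‖castV x‖) ^ 3 * Real.exp (b * ‖castV x‖)) c hc
  refine ⟨η, hη, fun ξ => tQ p (lam ξ), I, C, ?_, ?_, hIa, hI0, hI1, hI2, ?_⟩
  · intro i j ξ hξ
    obtain ⟨g1, g2, g3⟩ := hlam ξ (by simpa using hξ)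
    exact (hQa i j (lam ξ) (by simpa using g2)).comp g1
  · simp only [hl0, hQ0]
  · intro n hn x hx
    set ξ := (n : ℝ)⁻¹ • castV x with hξ
    obtain ⟨-, g2, g3⟩ := hlam ξ hx
    have hn0 : (n : ℝ) ≠ 0 := by positivity
    have hxn : castV x = (n : ℝ) • ξ := by rw [hξ, smul_smul, mul_inv_cancel₀ hn0, one_smul]
    obtain ⟨z1, z2⟩ := hZb _ g2
    have g2' := g2.le.trans hr1r
    obtain ⟨t1, t2, t3, t4, t5, t6⟩ := tilt_facts p hp_nonneg hb hr hW g2' z1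
    have hfin := hC _ _ _ t1 t2 t3 t4 t5 t6 (hdec _ g2' z1 z2) n hn x (by rw [g3, hxn])
    have e : convPowD (tq p (lam ξ)) n x = convPowD p n x * Real.exp (n * I ξ) := by
      unfold tq
      rw [convPow_tilt, hI, mul_div_assoc]
      congr 1
      rw [mul_sub, Real.exp_sub, hxn, dotProduct_smul, smul_eq_mul, Real.exp_nat_mul (Real.log _),
        Real.exp_log (hZp _ g2)]
    rwa [e] at hfin
end
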